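/- arXiv:1311.3200 — 7 statements merged into one kernel-verified Lean document; each statement's English description precedes it below -/
import Mathlib

section
/- Let (X_k)_{k≥1} be a {0,1}-valued stochastic process adapted to a filtration (F_k)_{k≥0} on a probability space, and let θ ∈ (0,1] be such that P(X_k = 1 | F_{k−1}) ≥ θ almost surely for every k ≥ 1. Then for every integer T ≥ 1, almost surely there exists an index k such that X_k = X_{k+1} = ⋯ = X_{k+T−1} = 1. -/
open MeasureTheory

/-- `successRun X n t` is the event that the `t` variables following `X n` all equal `1`. -/
def successRun {Ω : Type*} (X : ℕ → Ω → ℝ) (n t : ℕ) : Set Ω :=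
  {ω | ∀ i < t, X (n + 1 + i) ω = 1}

/-- `noSuccessRun X T m` is the event that none of the first `m` consecutive blocks of length `T`
consists only of ones. -/
def noSuccessRun {Ω : Type*} (X : ℕ → Ω → ℝ) (T m : ℕ) : Set Ω :=
  {ω | ∀ j < m, ω ∉ successRun X (j * T) T}

section

variable {Ω : Type*} {m0 : MeasurableSpace Ω} {μ : Measure Ω} {F : Filtration ℕ m0}
  {X : ℕ → Ω → ℝ} {θ : ℝ}

lemma successRun_zero (n : ℕ) : successRun X n 0 = Set.univ := by
  simp [successRun]

lemma successRun_succ (n t : ℕ) :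
    successRun X n (t + 1) = successRun X n t ∩ X (n + t + 1) ⁻¹' {1} := by
  ext ω
  simp only [successRun, Set.mem_ofPred_eq, Set.mem_inter_iff, Set.mem_preimage,
    Set.mem_singleton_iff, Nat.forall_lt_succ_right, add_right_comm n t 1]

lemma noSuccessRun_zero (T : ℕ) : noSuccessRun X T 0 = Set.univ := by
  simp [noSuccessRun]

lemma noSuccessRun_succ (T m : ℕ) :
    noSuccessRun X T (m + 1) = noSuccessRun X T m \ successRun X (m * T) T := by
  ext ω
  simp only [noSuccessRun, Set.mem_ofPred_eq, Set.mem_sdiff, Nat.forall_lt_succ_right]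

lemma measurableSet_successRun (hadapted : ∀ k, 1 ≤ k → StronglyMeasurable[F k] (X k))
    (n t : ℕ) : MeasurableSet[F (n + t)] (successRun X n t) := by
  induction t with
  | zero => rw [successRun_zero]; exact MeasurableSet.univ
  | succ t ih =>
    rw [successRun_succ]
    exact (F.mono (by omega) _ ih).inter
      ((hadapted (n + t + 1) (by omega)).measurable (measurableSet_singleton 1))

lemma measurableSet_noSuccessRun (hadapted : ∀ k, 1 ≤ k → StronglyMeasurable[F k] (X k))
    (T m : ℕ) : MeasurableSet[F (m * T)] (noSuccessRun X T m) := by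
  induction m with
  | zero => rw [noSuccessRun_zero]; exact MeasurableSet.univ
  | succ m ih =>
    rw [noSuccessRun_succ, Nat.succ_mul]
    exact (F.mono (by omega) _ ih).diff (measurableSet_successRun hadapted _ _)

/-- If the conditional expectation of a `{0,1}`-valued variable is at least `θ`, then the variable
equals `1` on at least a proportion `θ` of every event of the conditioning σ-algebra. -/
lemma mul_measureReal_le_measureReal_inter_preimage_one [IsFiniteMeasure μ]
    {m : MeasurableSpace Ω} (hm : m ≤ m0) {Y : Ω → ℝ} (hY : Measurable[m0] Y)
    (hval : ∀ ω, Y ω = 0 ∨ Y ω = 1) (hcond : ∀ᵐ ω ∂μ, θ ≤ (μ[Y | m]) ω)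
    {A : Set Ω} (hA : MeasurableSet[m] A) :
    θ * μ.real A ≤ μ.real (A ∩ Y ⁻¹' {1}) := by
  have hS : MeasurableSet[m0] (Y ⁻¹' {1}) := hY (measurableSet_singleton 1)
  have hind : Y = (Y ⁻¹' {1}).indicator 1 := by
    ext ω
    rcases hval ω with h | h <;> simp [Set.indicator, h]
  have hint : Integrable Y μ := by
    rw [hind]
    exact (integrable_const (1 : ℝ)).indicator hS
  have hY_int : ∫ ω in A, Y ω ∂μ = μ.real (A ∩ Y ⁻¹' {1}) := by
    conv_lhs => rw [hind]
    rw [integral_indicator_one hS, measureReal_restrict_apply hS, Set.inter_comm]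
  calc θ * μ.real A = ∫ _ in A, θ ∂μ := by rw [setIntegral_const, smul_eq_mul, mul_comm]
    _ ≤ ∫ ω in A, (μ[Y | m]) ω ∂μ :=
      setIntegral_mono_ae (integrable_const θ).integrableOn integrable_condExp.integrableOn hcond
    _ = μ.real (A ∩ Y ⁻¹' {1}) := by rw [setIntegral_condExp hm hint hA, hY_int]

lemma pow_mul_measureReal_le_measureReal_inter_successRun [IsFiniteMeasure μ] (hθ : 0 ≤ θ)
    (hval : ∀ k ω, 1 ≤ k → (X k ω = 0 ∨ X k ω = 1))
    (hadapted : ∀ k, 1 ≤ k → StronglyMeasurable[F k] (X k))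
    (hcond : ∀ k, 1 ≤ k → ∀ᵐ ω ∂μ, θ ≤ (μ[X k | F (k - 1)]) ω)
    {n : ℕ} {A : Set Ω} (hA : MeasurableSet[F n] A) (t : ℕ) :
    θ ^ t * μ.real A ≤ μ.real (A ∩ successRun X n t) := by
  induction t with
  | zero => simp [successRun_zero]
  | succ t ih =>
    have hk : 1 ≤ n + t + 1 := by omega
    rw [successRun_succ, ← Set.inter_assoc]
    calc θ ^ (t + 1) * μ.real A = θ * (θ ^ t * μ.real A) := by ring
      _ ≤ θ * μ.real (A ∩ successRun X n t) := by gcongr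
      _ ≤ μ.real (A ∩ successRun X n t ∩ X (n + t + 1) ⁻¹' {1}) :=
        mul_measureReal_le_measureReal_inter_preimage_one (F.le (n + t))
          ((hadapted _ hk).mono (F.le _)).measurable (fun ω => hval _ ω hk) (hcond _ hk)
          ((F.mono (by omega) _ hA).inter (measurableSet_successRun hadapted n t))

lemma measureReal_noSuccessRun_le [IsProbabilityMeasure μ] (hθ : θ ∈ Set.Ioc (0 : ℝ) 1)
    (hval : ∀ k ω, 1 ≤ k → (X k ω = 0 ∨ X k ω = 1))
    (hadapted : ∀ k, 1 ≤ k → StronglyMeasurable[F k] (X k))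
    (hcond : ∀ k, 1 ≤ k → ∀ᵐ ω ∂μ, θ ≤ (μ[X k | F (k - 1)]) ω) (T m : ℕ) :
    μ.real (noSuccessRun X T m) ≤ (1 - θ ^ T) ^ m := by
  induction m with
  | zero => simp [noSuccessRun_zero]
  | succ m ih =>
    have hrun := pow_mul_measureReal_le_measureReal_inter_successRun hθ.1.le hval hadapted hcond
      (measurableSet_noSuccessRun hadapted T m) T
    have hsplit := measureReal_inter_add_sdiff (μ := μ) (s := noSuccessRun X T m)
      (F.le _ _ (measurableSet_successRun hadapted (m * T) T))
    have hnonneg : 0 ≤ 1 - θ ^ T := sub_nonneg.2 (pow_le_one₀ hθ.1.le hθ.2)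
    rw [noSuccessRun_succ]
    calc μ.real (noSuccessRun X T m \ successRun X (m * T) T)
        ≤ (1 - θ ^ T) * μ.real (noSuccessRun X T m) := by linarith
      _ ≤ (1 - θ ^ T) * (1 - θ ^ T) ^ m := by gcongr
      _ = (1 - θ ^ T) ^ (m + 1) := by ring

end

/-- Let `(X_k)_{k≥1}` be a `{0,1}`-valued stochastic process adapted to a
filtration `(F_k)_{k≥0}` on a probability space, and let `θ ∈ (0,1]` be such that
`P(X_k = 1 | F_{k−1}) ≥ θ` almost surely for every `k ≥ 1` (since `X_k` takes values in `{0,1}`,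
this conditional probability is the conditional expectation `μ[X_k | F_{k−1}]`).
Then for every integer `T ≥ 1`, almost surely there exists an index `k` such that
`X_k = X_{k+1} = ⋯ = X_{k+T−1} = 1`. -/
theorem stmt1 {Ω : Type*} {m0 : MeasurableSpace Ω} (μ : Measure Ω) [IsProbabilityMeasure μ]
    (F : Filtration ℕ m0) (X : ℕ → Ω → ℝ) (θ : ℝ) (hθ : θ ∈ Set.Ioc (0 : ℝ) 1)
    (hval : ∀ k ω, 1 ≤ k → (X k ω = 0 ∨ X k ω = 1))
    (hadapted : ∀ k, 1 ≤ k → StronglyMeasurable[F k] (X k))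
    (hcond : ∀ k, 1 ≤ k → ∀ᵐ ω ∂μ, θ ≤ (μ[X k | F (k - 1)]) ω)
    (T : ℕ) (hT : 1 ≤ T) :
    ∀ᵐ ω ∂μ, ∃ k, 1 ≤ k ∧ ∀ i < T, X (k + i) ω = 1 := by
  have hpow : 0 < θ ^ T := pow_pos hθ.1 T
  have hpow_le : θ ^ T ≤ 1 := pow_le_one₀ hθ.1.le hθ.2
  have hlim := tendsto_pow_atTop_nhds_zero_of_lt_one (sub_nonneg.2 hpow_le)
    (sub_lt_self 1 hpow)
  have hnull : μ.real (⋂ m, noSuccessRun X T m) = 0 :=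
    le_antisymm (ge_of_tendsto' hlim fun m =>
      (measureReal_mono (Set.iInter_subset _ m)).trans
        (measureReal_noSuccessRun_le hθ hval hadapted hcond T m)) measureReal_nonneg
  filter_upwards [measure_eq_zero_iff_ae_notMem.1 ((measureReal_eq_zero_iff).1 hnull)] with ω hω
  simp only [Set.mem_iInter, noSuccessRun, Set.mem_ofPred_eq, not_forall, not_not] at hω
  obtain ⟨_, j, _, hj⟩ := hω
  exact ⟨j * T + 1, by omega, hj⟩
end

section
/- For all integers m ≥ 1 and a ≥ 1, if m balls are thrown into a bins, each ball independently into a uniformly random bin, then the probability that no bin receives two or more balls is at most 2·exp(−(m²/(2a))·e^{−m/a}). -/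
theorem card_filter_injective_fin (m a : ℕ) :
    (Finset.univ.filter fun f : Fin m → Fin a => Function.Injective f).card =
      a.descFactorial m := by
  classical
  rw [← Fintype.card_subtype,
    Fintype.card_congr (Equiv.subtypeInjectiveEquivEmbedding (Fin m) (Fin a)),
    Fintype.card_embedding_eq, Fintype.card_fin, Fintype.card_fin]

theorem descFactorial_le_pow_mul_exp {a : ℕ} (ha : 1 ≤ a) :
    ∀ {m : ℕ}, m ≤ a → (a.descFactorial m : ℝ) ≤
      (a : ℝ) ^ m * Real.exp (-((m : ℝ) * ((m : ℝ) - 1) / (2 * (a : ℝ)))) := by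
  have ha' : (0 : ℝ) < a := by exact_mod_cast ha
  intro m
  induction m with
  | zero => simp
  | succ k ih =>
    intro hk
    have h_factor : (a : ℝ) - k ≤ a * Real.exp (-((k : ℝ) / a)) := by
      calc (a : ℝ) - k = a * (-((k : ℝ) / a) + 1) := by field_simp; ring
        _ ≤ _ := by gcongr; exact Real.add_one_le_exp _
    rw [Nat.descFactorial_succ, Nat.cast_mul, Nat.cast_sub (by omega)]
    calc ((a : ℝ) - k) * (a.descFactorial k : ℝ)
        ≤ (a * Real.exp (-((k : ℝ) / a))) *
          ((a : ℝ) ^ k * Real.exp (-((k : ℝ) * ((k : ℝ) - 1) / (2 * (a : ℝ))))) :=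
          mul_le_mul h_factor (ih (by omega)) (by positivity) (by positivity)
      _ = (a : ℝ) ^ (k + 1) * (Real.exp (-((k : ℝ) / a)) *
          Real.exp (-((k : ℝ) * ((k : ℝ) - 1) / (2 * (a : ℝ))))) := by ring
      _ = _ := by
        rw [← Real.exp_add]
        congr 2
        push_cast
        field_simp
        ring


/-- If `m ≥ 1` balls are thrown into `a ≥ 1` bins, each ball independently
into a uniformly random bin (sample space: functions `Fin m → Fin a` with the uniform
probability measure), then the probability that no bin receives two or more balls (i.e. the
function is injective) is at most `2·exp(−(m²/(2a))·e^{−m/a})`. -/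
theorem stmt9 (m a : ℕ) (hm : 1 ≤ m) (ha : 1 ≤ a) :
    ((Finset.univ.filter fun f : Fin m → Fin a => Function.Injective f).card : ℝ)
        / ((a : ℝ) ^ m)
      ≤ 2 * Real.exp (-(((m : ℝ) ^ 2 / (2 * (a : ℝ))) * Real.exp (-(m : ℝ) / (a : ℝ)))) := by
  have ha' : (0 : ℝ) < a := by exact_mod_cast ha
  rw [card_filter_injective_fin]
  rcases lt_or_ge a m with h_lt | h_le
  · rw [Nat.descFactorial_of_lt h_lt, Nat.cast_zero, zero_div]
    positivity
  rw [div_le_iff₀ (by positivity), mul_comm]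
  refine (descFactorial_le_pow_mul_exp ha h_le).trans ?_
  gcongr
  have h_ratio : (m : ℝ) / a ≤ 1 := (div_le_one ha').2 (by exact_mod_cast h_le)
  have h_exp : Real.exp (-(m : ℝ) / a) ≤ 1 :=
    Real.exp_le_one_iff.2 (div_nonpos_of_nonpos_of_nonneg (by simp) ha'.le)
  have h_mul : (m : ℝ) ^ 2 / (2 * a) * Real.exp (-(m : ℝ) / a) ≤ (m : ℝ) ^ 2 / (2 * a) :=
    mul_le_of_le_one_right (by positivity) h_exp
  have h_split : (m : ℝ) * ((m : ℝ) - 1) / (2 * a) = (m : ℝ) ^ 2 / (2 * a) - m / a / 2 := by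
    field_simp
  calc Real.exp (-((m : ℝ) * ((m : ℝ) - 1) / (2 * a)))
      ≤ Real.exp (Real.log 2 + -((m : ℝ) ^ 2 / (2 * a) * Real.exp (-(m : ℝ) / a))) :=
        Real.exp_le_exp.2 (by linarith [Real.log_two_gt_d9])
    _ = _ := by rw [Real.exp_add, Real.exp_log two_pos]
end

section
/- For all integers m ≥ 1 and b ≥ 1, if m balls are thrown into b bins, each ball independently into a uniformly random bin, then the probability that no bin receives three or more balls is at most 2·exp(−(m³/(6b²))·e^{−m/b}). -/
/-- The number of maps `Fin k → ι` whose fibre over each `j` has at most `c j` elements. -/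
def boundedFiberCount {ι : Type*} [Fintype ι] [DecidableEq ι] (c : ι → ℕ) (k : ℕ) : ℕ :=
  (Finset.univ.filter fun f : Fin k → ι =>
    ∀ j, (Finset.univ.filter fun i => f i = j).card ≤ c j).card

theorem boundedFiberCount_zero {ι : Type*} [Fintype ι] [DecidableEq ι] (c : ι → ℕ) :
    boundedFiberCount c 0 = 1 := by
  simp [boundedFiberCount]

theorem boundedFiberCount_mono {ι : Type*} [Fintype ι] [DecidableEq ι] {c d : ι → ℕ}
    (h : c ≤ d) (k : ℕ) : boundedFiberCount c k ≤ boundedFiberCount d k :=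
  Finset.card_le_card <| Finset.monotone_filter_right _ fun _ _ hf j => (hf j).trans (h j)

theorem boundedFiberCount_succ {ι : Type*} [Fintype ι] [DecidableEq ι] (c : ι → ℕ) (k : ℕ) :
    boundedFiberCount c (k + 1) =
      ∑ j, if 0 < c j then boundedFiberCount (Function.update c j (c j - 1)) k else 0 := by
  simp only [boundedFiberCount, Finset.card_filter _ Finset.univ]
  rw [← (Fin.consEquiv fun _ : Fin (k + 1) => ι).sum_comp, Fintype.sum_prod_type]
  refine Finset.sum_congr rfl fun j _ => ?_
  trans ∑ g : Fin k → ι, if 0 < c j then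
      (if ∀ i, (∑ l, if g l = i then 1 else 0) ≤ Function.update c j (c j - 1) i then 1 else 0) else 0
  swap
  · split_ifs <;> simp
  refine Finset.sum_congr rfl fun g _ => ?_
  rw [← ite_and]
  refine if_congr ?_ rfl rfl
  simp only [Fin.consEquiv, Equiv.coe_fn_mk, Fin.sum_univ_succ, Fin.cons_zero, Fin.cons_succ]
  constructor
  · intro h
    refine ⟨by have := h j; simp at this; omega, fun i => ?_⟩
    rcases eq_or_ne i j with rfl | hij
    · have := h i; simp at this ⊢; omega
    · have := h i; simp [hij, hij.symm] at this ⊢; omega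
  · rintro ⟨hj, h⟩ i
    rcases eq_or_ne i j with rfl | hij
    · have := h i; simp at this ⊢; omega
    · have := h i; simp [hij, hij.symm] at this ⊢; omega

theorem boundedFiberCount_succ_le {ι : Type*} [Fintype ι] [DecidableEq ι] (c : ι → ℕ) (k : ℕ) :
    boundedFiberCount c (k + 1) ≤ Fintype.card ι * boundedFiberCount c k := by
  rw [boundedFiberCount_succ, ← smul_eq_mul, Fintype.card, ← Finset.sum_const]
  refine Finset.sum_le_sum fun j _ => ?_
  split_ifs
  · exact boundedFiberCount_mono (update_le_self_iff.2 (Nat.sub_le _ _)) k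
  · exact Nat.zero_le _

theorem boundedFiberCount_add_le {ι : Type*} [Fintype ι] [DecidableEq ι] (c : ι → ℕ) (k n : ℕ) :
    boundedFiberCount c (k + n) ≤ Fintype.card ι ^ n * boundedFiberCount c k := by
  induction n with
  | zero => simp
  | succ n ih =>
    calc boundedFiberCount c (k + n + 1)
        ≤ Fintype.card ι * boundedFiberCount c (k + n) := boundedFiberCount_succ_le c _
      _ ≤ Fintype.card ι * (Fintype.card ι ^ n * boundedFiberCount c k) := by gcongr
      _ = Fintype.card ι ^ (n + 1) * boundedFiberCount c k := by ring

open Polynomial in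
/-- The truncated exponential `∑_{i ≤ n} X ^ i / i!`. -/
noncomputable def truncExp (n : ℕ) : ℝ[X] :=
  ∑ i ∈ Finset.range (n + 1), C ((i.factorial : ℝ)⁻¹) * X ^ i

open Polynomial in
theorem eval_truncExp (n : ℕ) (x : ℝ) :
    (truncExp n).eval x = ∑ i ∈ Finset.range (n + 1), x ^ i / i.factorial := by
  simp [truncExp, eval_finsetSum, div_eq_inv_mul]

open Polynomial in
theorem derivative_truncExp_succ (n : ℕ) : derivative (truncExp (n + 1)) = truncExp n := by
  simp only [truncExp]
  rw [Finset.sum_range_succ', derivative_add, derivative_sum]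
  simp only [derivative_mul, derivative_C, derivative_X_pow, pow_zero, mul_one, zero_mul, zero_add,
    add_zero]
  refine Finset.sum_congr rfl fun i _ => ?_
  rw [← mul_assoc, ← C_mul, Nat.add_sub_cancel, Nat.factorial_succ]
  congr 2
  push_cast
  field_simp

open Polynomial in
theorem derivative_prod_truncExp {ι : Type*} [Fintype ι] [DecidableEq ι] (c : ι → ℕ) :
    derivative (∏ j, truncExp (c j)) =
      ∑ j, if 0 < c j then ∏ i, truncExp (Function.update c j (c j - 1) i) else 0 := by
  rw [derivative_prod_finset]
  refine Finset.sum_congr rfl fun j _ => ?_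
  split_ifs with h
  · rw [← Finset.prod_erase_mul _ _ (Finset.mem_univ j)]
    obtain ⟨n, hn⟩ := Nat.exists_eq_add_of_lt h
    congr 1
    · refine Finset.prod_congr rfl fun i hi => ?_
      rw [Function.update_of_ne (Finset.ne_of_mem_erase hi)]
    · rw [Function.update_self, hn, zero_add, derivative_truncExp_succ, Nat.add_sub_cancel]
  · rw [Nat.eq_zero_of_not_pos h]
    simp [truncExp]

open Polynomial in
/-- The exponential generating function of `boundedFiberCount c` is a product of truncated
exponentials. -/
theorem coeff_prod_truncExp {ι : Type*} [Fintype ι] [DecidableEq ι] (c : ι → ℕ) (k : ℕ) :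
    (∏ j, truncExp (c j)).coeff k = boundedFiberCount c k / k.factorial := by
  induction k generalizing c with
  | zero =>
    rw [coeff_zero_eq_eval_zero, eval_prod, boundedFiberCount_zero]
    simp [eval_truncExp, Finset.sum_range_succ']
  | succ k ih =>
    have h := congrArg (coeff · k) (derivative_prod_truncExp c)
    simp only [coeff_derivative, finsetSum_coeff, apply_ite (coeff · k), ih, coeff_zero] at h
    rw [boundedFiberCount_succ, Nat.factorial_succ]
    push_cast
    rw [mul_comm, ← div_div, eq_div_iff (by positivity), h, Finset.sum_div]
    simp only [ite_div, zero_div]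

theorem sum_boundedFiberCount_le {ι : Type*} [Fintype ι] [DecidableEq ι] (c : ι → ℕ) (n : ℕ)
    {x : ℝ} (hx : 0 ≤ x) :
    ∑ k ∈ Finset.range n, boundedFiberCount c k / k.factorial * x ^ k ≤
      ∏ j, ∑ i ∈ Finset.range (c j + 1), x ^ i / i.factorial := by
  simp only [← eval_truncExp, ← Polynomial.eval_prod]
  rw [Polynomial.eval_eq_sum_range' (lt_of_lt_of_le (Nat.lt_succ_self _) (le_max_right n _))]
  simp only [coeff_prod_truncExp]
  exact Finset.sum_le_sum_of_subset_of_nonneg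
    (Finset.range_subset_range.2 (le_max_left _ _)) fun _ _ _ => by positivity

theorem one_sub_mul_exp_le {u : ℝ} (hu : 0 ≤ u) :
    (1 - u) * Real.exp u ≤ (1 + u) * Real.exp (-u) := by
  have hd (x : ℝ) : HasDerivAt (fun x => (1 + x) * Real.exp (-x) - (1 - x) * Real.exp x)
      (x * (Real.exp x - Real.exp (-x))) x := by
    refine ((((hasDerivAt_id x).const_add 1).mul (hasDerivAt_id x).neg.exp).sub
      (((hasDerivAt_id x).const_sub 1).mul (Real.hasDerivAt_exp x))).congr_deriv ?_
    simp
    ring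
  have hm := monotoneOn_of_deriv_nonneg (convex_Ici (0 : ℝ))
    (fun x _ => (hd x).continuousAt.continuousWithinAt)
    (fun x _ => (hd x).differentiableAt.differentiableWithinAt) fun x hx => by
      rw [interior_Ici, Set.mem_Ioi] at hx
      rw [(hd x).deriv]
      exact mul_nonneg hx.le (sub_nonneg.2 (Real.exp_le_exp.2 (by linarith)))
  have := hm Set.self_mem_Ici hu hu
  simp at this
  linarith

open Polynomial in
theorem hasDerivAt_exp_neg_mul_truncExp (n : ℕ) (x : ℝ) :
    HasDerivAt (fun x => Real.exp (-x) * (truncExp n).eval x)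
      (-(Real.exp (-x) * (x ^ n / n.factorial))) x := by
  refine ((hasDerivAt_id x).neg.exp.mul ((truncExp n).hasDerivAt x)).congr_deriv ?_
  cases n with
  | zero => simp [truncExp]
  | succ n =>
    rw [derivative_truncExp_succ, eval_truncExp, eval_truncExp, Finset.sum_range_succ _ (n + 1)]
    simp
    ring

/-- The median of a Poisson distribution with integer mean `m` is at most `m`. -/
theorem exp_le_two_mul_sum_range_succ (m : ℕ) :
    Real.exp m ≤ 2 * ∑ k ∈ Finset.range (m + 1), (m : ℝ) ^ k / k.factorial := by
  rcases Nat.eq_zero_or_pos m with rfl | hm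
  · simp
  have hm' : (0 : ℝ) < m := by exact_mod_cast hm
  set Q : ℝ → ℝ := fun x => Real.exp (-x) * (truncExp m).eval x with hQ
  have hd (s : ℝ) : HasDerivAt (fun s => Q (m + s) + Q (m - s))
      (-(Real.exp (-(m + s)) * ((m + s) ^ m / m.factorial)) +
        Real.exp (-(m - s)) * ((m - s) ^ m / m.factorial)) s := by
    have h₁ := (hasDerivAt_exp_neg_mul_truncExp m (m + s)).comp s
      ((hasDerivAt_id s).const_add (m : ℝ))
    have h₂ := (hasDerivAt_exp_neg_mul_truncExp m (m - s)).comp s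
      ((hasDerivAt_id s).const_sub (m : ℝ))
    exact (h₁.add h₂).congr_deriv (by ring)
  have hanti := antitoneOn_of_deriv_nonpos (convex_Icc (0 : ℝ) m)
    (fun x _ => (hd x).continuousAt.continuousWithinAt)
    (fun x _ => (hd x).differentiableAt.differentiableWithinAt) fun s hs => by
      rw [interior_Icc] at hs
      rw [(hd s).deriv]
      have hu : 0 ≤ s / m := div_nonneg hs.1.le hm'.le
      have hu1 : s / m ≤ 1 := (div_le_one hm').2 hs.2.le
      have key := pow_le_pow_left₀ (mul_nonneg (sub_nonneg.2 hu1) (Real.exp_pos _).le)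
        (one_sub_mul_exp_le hu) m
      rw [mul_pow, mul_pow, ← Real.exp_nat_mul, ← Real.exp_nat_mul, mul_neg,
        mul_div_cancel₀ _ hm'.ne'] at key
      have e₁ : (m : ℝ) + s = m * (1 + s / m) := by field_simp
      have e₂ : (m : ℝ) - s = m * (1 - s / m) := by field_simp
      have key' := mul_le_mul_of_nonneg_left key
        (show 0 ≤ (m : ℝ) ^ m / m.factorial * Real.exp (-m) by positivity)
      have x₁ : Real.exp (-(m + s)) = Real.exp (-m) * Real.exp (-s) := by
        rw [← Real.exp_add]; ring_nf
      have x₂ : Real.exp (-(m - s)) = Real.exp (-m) * Real.exp s := by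
        rw [← Real.exp_add]; ring_nf
      rw [x₁, x₂, e₁, e₂, mul_pow, mul_pow]
      linear_combination key'
  have h := hanti (Set.left_mem_Icc.2 hm'.le) (Set.right_mem_Icc.2 hm'.le) hm'.le
  have h0 : Q 0 = 1 := by simp [hQ, eval_truncExp, Finset.sum_range_succ']
  have h2 : 0 ≤ Q (m + m) := by
    simp only [hQ, eval_truncExp]
    positivity
  simp only [add_zero, sub_zero, sub_self, h0] at h
  have h3 : 1 ≤ 2 * Q m := by linarith
  simp only [hQ, eval_truncExp, Real.exp_neg] at h3
  have he := Real.exp_pos m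
  calc Real.exp m ≤ Real.exp m * (2 * ((Real.exp m)⁻¹ * _)) := le_mul_of_one_le_right he.le h3
    _ = _ := by field_simp

theorem sum_range_three_le_exp {x : ℝ} (hx : 0 ≤ x) :
    ∑ i ∈ Finset.range 3, x ^ i / i.factorial ≤
      Real.exp x * Real.exp (-(x ^ 3 / 6 * Real.exp (-x))) := by
  have h := Real.sum_le_exp_of_nonneg hx 4
  rw [Finset.sum_range_succ] at h
  have h1 := Real.one_sub_le_exp_neg (x ^ 3 / 6 * Real.exp (-x))
  have h2 := mul_le_mul_of_nonneg_left h1 (Real.exp_pos x).le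
  have h3 : Real.exp x * Real.exp (-x) = 1 := by rw [← Real.exp_add]; simp
  have h4 : (Nat.factorial 3 : ℝ) = 6 := by norm_num [Nat.factorial]
  rw [h4] at h
  linear_combination h + h2 + x ^ 3 / 6 * h3


/-- If `m ≥ 1` balls are thrown into `b ≥ 1` bins, each ball independently
into a uniformly random bin (sample space: functions `Fin m → Fin b` with the uniform
probability measure), then the probability that no bin receives three or more balls (i.e.
every bin has at most two preimages) is at most `2·exp(−(m³/(6b²))·e^{−m/b})`. -/
theorem stmt10 (m b : ℕ) (hm : 1 ≤ m) (hb : 1 ≤ b) :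
    ((Finset.univ.filter fun f : Fin m → Fin b =>
          ∀ j : Fin b, (Finset.univ.filter fun i : Fin m => f i = j).card ≤ 2).card : ℝ)
        / ((b : ℝ) ^ m)
      ≤ 2 * Real.exp (-(((m : ℝ) ^ 3 / (6 * (b : ℝ) ^ 2)) * Real.exp (-(m : ℝ) / (b : ℝ)))) := by
  have hcount : (Finset.univ.filter fun f : Fin m → Fin b =>
      ∀ j : Fin b, (Finset.univ.filter fun i : Fin m => f i = j).card ≤ 2).card =
        boundedFiberCount (fun _ : Fin b => 2) m := by
    unfold boundedFiberCount
    congr!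
  rw [hcount]
  have hb' : (0 : ℝ) < b := by exact_mod_cast hb
  set N := boundedFiberCount (fun _ : Fin b => 2)
  set E := Real.exp (-(((m : ℝ) ^ 3 / (6 * (b : ℝ) ^ 2)) * Real.exp (-(m : ℝ) / (b : ℝ))))
  have hx : (0 : ℝ) ≤ m / b := by positivity
  have upper : ∑ k ∈ Finset.range (m + 1), (N k : ℝ) / k.factorial * (m / b : ℝ) ^ k ≤
      Real.exp m * E := by
    refine (sum_boundedFiberCount_le _ _ hx).trans ?_
    rw [Finset.prod_const, Finset.card_univ, Fintype.card_fin]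
    refine (pow_le_pow_left₀ (by positivity) (sum_range_three_le_exp hx) b).trans_eq ?_
    rw [mul_pow, ← Real.exp_nat_mul, ← Real.exp_nat_mul]
    congr 2
    · field_simp
    · rw [neg_div]
      field_simp
  have lower : (N m : ℝ) / (b : ℝ) ^ m * ∑ k ∈ Finset.range (m + 1), (m : ℝ) ^ k / k.factorial ≤
      ∑ k ∈ Finset.range (m + 1), (N k : ℝ) / k.factorial * (m / b : ℝ) ^ k := by
    rw [Finset.mul_sum]
    refine Finset.sum_le_sum fun k hk => ?_
    obtain ⟨n, hn⟩ := Nat.exists_eq_add_of_le (Finset.mem_range_succ_iff.1 hk)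
    have hN : (N m : ℝ) ≤ (b : ℝ) ^ n * N k := by
      have := boundedFiberCount_add_le (fun _ : Fin b => 2) k n
      rw [Fintype.card_fin, ← hn] at this
      exact_mod_cast this
    have hp : (N m : ℝ) / (b : ℝ) ^ m ≤ N k / (b : ℝ) ^ k := by
      rw [div_le_div_iff₀ (by positivity) (by positivity)]
      have hpow : (b : ℝ) ^ m = b ^ k * b ^ n := by rw [← pow_add, ← hn]
      rw [hpow]
      linear_combination (b : ℝ) ^ k * hN
    refine (mul_le_mul_of_nonneg_right hp (by positivity)).trans_eq ?_
    rw [div_pow]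
    ring
  have hp0 : (0 : ℝ) ≤ N m / (b : ℝ) ^ m := by positivity
  have hmed := mul_le_mul_of_nonneg_left (exp_le_two_mul_sum_range_succ m) hp0
  refine le_of_mul_le_mul_right ?_ (Real.exp_pos m)
  linear_combination hmed + 2 * lower + 2 * upper
end

section
/- Let α ≥ 4 be a constant. There exists n₀ such that for all n ≥ n₀ and all nonnegative integers a, b with a + b = n, the following holds. Consider n bins, of which a initially contain one ball and b initially contain zero balls; balls are thrown one per step into a bin chosen independently and uniformly at random among all n bins, and T is the first step at which some bin contains three balls. Then T ≤ 2α·min(n·√(log n)/√a, n·(log n)^{1/3}/b^{1/3}) with probability at least 1 − 1/n^α (where a term with denominator 0 is interpreted as +∞). -/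
open scoped Classical

/-- The first step at which some bin contains three balls, in the game where the bins
`j < a` start with one ball and the remaining bins start empty: the least `k` such that after
the first `k` throws of `f` some bin holds at least three balls.  (At most `2n + 1` throws can
occur before some bin holds three balls, so restricting the infinite i.i.d. sequence of uniform
throws to its first `2n + 1` throws gives exactly the distribution of this stopping time.) -/
noncomputable def firstPhaseEnd (n a m : ℕ) (f : Fin m → Fin n) : ℕ :=
  sInf {k | ∃ j : Fin n,
    3 ≤ (if (j : ℕ) < a then 1 else 0)
        + (Finset.univ.filter fun i : Fin m => (i : ℕ) < k ∧ f i = j).card}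

theorem card_fiberCard_eq_mul_prod_factorial_le {κ : Type*} [Fintype κ] [DecidableEq κ] (K : ℕ) (k : κ → ℕ) :
    (Finset.univ.filter fun f : Fin K → κ =>
        ∀ j, (Finset.univ.filter fun i => f i = j).card = k j).card
      * ∏ j, (k j).factorial ≤ K.factorial := by
  set d : κ →₀ ℕ := Finsupp.equivFunOnFinite.symm k with hd
  have hsum : (∑ j : κ, MvPolynomial.X j : MvPolynomial κ ℕ) ^ K
      = ∑ f : Fin K → κ, MvPolynomial.monomial (∑ i, Finsupp.single (f i) 1) 1 := by
    rw [Finset.sum_pow']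
    simp only [Fintype.piFinset_univ]
    refine Finset.sum_congr rfl fun f _ => ?_
    rw [MvPolynomial.monomial_sum_one]
    rfl
  have hcoeff := congrArg (MvPolynomial.coeff d) hsum
  rw [MvPolynomial.coeff_sum_X_pow_of_fintype, MvPolynomial.coeff_sum] at hcoeff
  simp only [MvPolynomial.coeff_monomial, Finset.sum_boole] at hcoeff
  have hset : (Finset.univ.filter fun f : Fin K → κ =>
      ∀ j, (Finset.univ.filter fun i => f i = j).card = k j)
      = Finset.univ.filter fun f : Fin K → κ => ∑ i, Finsupp.single (f i) 1 = d := by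
    ext f
    simp only [Finset.mem_filter, Finset.mem_univ, true_and, DFunLike.ext_iff,
      Finsupp.finsetSum_apply, Finsupp.single_apply, Finset.sum_boole, Nat.cast_id]
    rfl
  rw [hset]
  simp only [Nat.cast_id] at hcoeff
  rw [← hcoeff]
  split_ifs with h
  · have hm := Nat.multinomial_spec Finset.univ k
    have he : d.multinomial = Nat.multinomial Finset.univ k := by
      rw [← Finsupp.multinomial_of_support_subset (Finset.subset_univ d.support)]
      rfl
    have hs : ∑ j, k j = K := by
      rw [Finsupp.sum_fintype _ _ (by simp)] at h
      exact h
    rw [he, mul_comm]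
    rw [hs] at hm
    exact hm.le
  · simp

theorem card_fiberCard_le_mul_pow_le {κ : Type*} [Fintype κ] [DecidableEq κ] (K : ℕ) (c : κ → ℕ) {x : ℝ}
    (hx : 0 ≤ x) :
    ((Finset.univ.filter fun f : Fin K → κ =>
        ∀ j, (Finset.univ.filter fun i => f i = j).card ≤ c j).card : ℝ) * x ^ K
      ≤ K.factorial * ∏ j, ∑ i ∈ Finset.range (c j + 1), x ^ i / i.factorial := by
  rw [Finset.prod_univ_sum, Finset.mul_sum,
    Finset.card_eq_sum_card_fiberwise
      (f := fun (f : Fin K → κ) j => (Finset.univ.filter fun i => f i = j).card)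
      (t := Fintype.piFinset fun j => Finset.range (c j + 1))]
  · push_cast
    rw [Finset.sum_mul]
    refine Finset.sum_le_sum fun k _ => ?_
    rw [Finset.filter_filter]
    set s := Finset.univ.filter fun f : Fin K → κ =>
      (∀ j, (Finset.univ.filter fun i => f i = j).card ≤ c j) ∧
        (fun j => (Finset.univ.filter fun i => f i = j).card) = k with hs
    rcases s.eq_empty_or_nonempty with h0 | ⟨f, hf⟩
    · rw [h0]
      simp only [Finset.card_empty, Nat.cast_zero, zero_mul]
      positivity
    · have hk : ∑ j, k j = K := by
        have := (Finset.mem_filter.1 hf).2.2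
        rw [← this, ← Finset.card_eq_sum_card_fiberwise (f := f) (t := Finset.univ)]
        · simp
        · simp
      have hle : s.card * ∏ j, (k j).factorial ≤ K.factorial := by
        refine le_trans (Nat.mul_le_mul_right _ (Finset.card_le_card fun g hg => ?_))
          (card_fiberCard_eq_mul_prod_factorial_le K k)
        exact Finset.mem_filter.2 ⟨Finset.mem_univ _, fun j =>
          congrFun (Finset.mem_filter.1 hg).2.2 j⟩
      rw [Finset.prod_div_distrib, Finset.prod_pow_eq_pow_sum, hk, ← mul_div_assoc,
        le_div_iff₀ (by positivity), mul_right_comm]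
      gcongr
      exact_mod_cast hle
  · intro f hf
    simp only [Finset.coe_filter, Finset.mem_univ, true_and, Set.mem_ofPred_eq] at hf
    simpa [Nat.lt_succ_iff] using hf

theorem factorial_mul_exp_le {K : ℕ} (hK : 1 ≤ K) :
    (K.factorial : ℝ) * Real.exp K ≤ Real.exp 1 * K * (K : ℝ) ^ K := by
  induction K, hK using Nat.le_induction with
  | base => simp
  | succ K hK ih =>
    have hK0 : (0 : ℝ) < K := by exact_mod_cast hK
    have hlog : Real.exp 1 * (K : ℝ) ^ (K + 1) ≤ ((K : ℝ) + 1) ^ (K + 1) := by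
      have h1 : (K : ℝ) / (K + 1) ≤ Real.exp (-(1 / (K + 1))) := by
        have := Real.add_one_le_exp (-(1 / ((K : ℝ) + 1)))
        refine le_trans (le_of_eq ?_) this
        field_simp
        ring
      have h2 : ((K : ℝ) / (K + 1)) ^ (K + 1) ≤ Real.exp (-1) := by
        refine (pow_le_pow_left₀ (by positivity) h1 _).trans (le_of_eq ?_)
        rw [← Real.exp_nat_mul]
        congr 1
        push_cast
        field_simp
      rw [div_pow, div_le_iff₀ (by positivity), Real.exp_neg] at h2
      rwa [← le_inv_mul_iff₀ (Real.exp_pos 1)]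
    rw [Nat.factorial_succ]
    push_cast
    rw [Real.exp_add]
    calc ((K : ℝ) + 1) * K.factorial * (Real.exp K * Real.exp 1)
        = (K + 1) * Real.exp 1 * (K.factorial * Real.exp K) := by ring
      _ ≤ (K + 1) * Real.exp 1 * (Real.exp 1 * K * (K : ℝ) ^ K) := by gcongr
      _ = (K + 1) * Real.exp 1 * (Real.exp 1 * (K : ℝ) ^ (K + 1)) := by ring
      _ ≤ (K + 1) * Real.exp 1 * ((K : ℝ) + 1) ^ (K + 1) := by gcongr
      _ = _ := by ring

theorem one_add_le_exp_sub_sq {x : ℝ} (h0 : 0 ≤ x) (h1 : x ≤ 1 / 10) :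
    1 + x ≤ Real.exp (x - x ^ 2 / 3) := by
  have hu : 0 ≤ x - x ^ 2 / 3 := by nlinarith
  refine le_trans ?_ (Real.quadratic_le_exp_of_nonneg hu)
  have : (9 / 10) * x ≤ x - x ^ 2 / 3 := by nlinarith
  have := pow_le_pow_left₀ (by positivity) this 2
  nlinarith

theorem one_add_add_sq_le_exp_sub_cube {x : ℝ} (h0 : 0 ≤ x) (h1 : x ≤ 1 / 10) :
    1 + x + x ^ 2 / 2 ≤ Real.exp (x - x ^ 3 / 8) := by
  have h2 : x ^ 2 ≤ 1 / 100 := by nlinarith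
  have hu0 : (799 / 800) * x ≤ x - x ^ 3 / 8 := by nlinarith
  have hu : 0 ≤ x - x ^ 3 / 8 := le_trans (by positivity) hu0
  have h := Real.sum_le_exp_of_nonneg hu 4
  simp only [Finset.sum_range_succ, Finset.sum_range_zero, Nat.factorial] at h
  refine le_trans ?_ h
  have h3 := pow_le_pow_left₀ (by positivity) hu0 3
  have h4 : 0 ≤ x ^ 3 := by positivity
  have h5 : 0 ≤ x ^ 3 * (1 / 10 - x) := mul_nonneg h4 (by linarith)
  have h6 : 0 ≤ x ^ 6 := by positivity
  norm_num at h3 ⊢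
  nlinarith

theorem card_fiberCard_le_two_le {n a b K : ℕ} (hab : a + b = n) (hK : 1 ≤ K)
    (hKn : 10 * K ≤ n) :
    ((Finset.univ.filter fun f : Fin K → Fin n =>
        ∀ j, (Finset.univ.filter fun i => f i = j).card
          ≤ if (j : ℕ) < a then 1 else 2).card : ℝ)
      ≤ (n : ℝ) ^ K * (n * Real.exp (-(a * ((K : ℝ) / n) ^ 2 / 3 + b * ((K : ℝ) / n) ^ 3 / 8))) := by
  have hK0 : (0 : ℝ) < K := by exact_mod_cast hK
  have hKn' : 10 * (K : ℝ) ≤ n := by exact_mod_cast hKn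
  have hn0 : (0 : ℝ) < n := by linarith
  set x : ℝ := (K : ℝ) / n with hx
  have hx0 : 0 < x := by positivity
  have hx1 : x ≤ 1 / 10 := by rw [hx, div_le_iff₀ hn0]; linarith
  have hxn : x * n = K := by rw [hx]; field_simp
  set E : ℝ := a * x ^ 2 / 3 + b * x ^ 3 / 8 with hE
  set N : ℝ := ((Finset.univ.filter fun f : Fin K → Fin n =>
        ∀ j, (Finset.univ.filter fun i => f i = j).card
          ≤ if (j : ℕ) < a then 1 else 2).card : ℝ) with hN
  have h : N * x ^ K ≤ K.factorial * ∏ j : Fin n,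
      ∑ i ∈ Finset.range ((if (j : ℕ) < a then 1 else 2) + 1), x ^ i / i.factorial := by
    convert card_fiberCard_le_mul_pow_le K (fun j : Fin n => if (j : ℕ) < a then 1 else 2) hx0.le
  have hprod : ∏ j : Fin n, ∑ i ∈ Finset.range ((if (j : ℕ) < a then 1 else 2) + 1),
      x ^ i / i.factorial ≤ Real.exp (K - E) := by
    have hexp : Real.exp (K - E)
        = Real.exp (x - x ^ 2 / 3) ^ a * Real.exp (x - x ^ 3 / 8) ^ b := by
      rw [← Real.exp_nat_mul, ← Real.exp_nat_mul, ← Real.exp_add, ← hxn, hE, ← hab]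
      congr 1
      push_cast
      ring
    rw [hexp]
    clear_value N x
    subst hab
    rw [Fin.prod_univ_add]
    simp only [Fin.val_castAdd, Fin.is_lt, if_true, Fin.val_natAdd, Nat.not_lt.2 (Nat.le_add_right _ _),
      if_false, Finset.prod_const, Finset.card_univ, Fintype.card_fin]
    have h1 := one_add_le_exp_sub_sq hx0.le hx1
    have h2 := one_add_add_sq_le_exp_sub_cube hx0.le hx1
    simp only [Finset.sum_range_succ, Finset.sum_range_zero, Nat.factorial]
    norm_num
    gcongr
  have hen : Real.exp 1 * K ≤ n := by
    have := Real.exp_one_lt_d9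
    nlinarith
  have hmain : N * x ^ K ≤ n * Real.exp (-E) * (K : ℝ) ^ K := by
    calc N * x ^ K ≤ K.factorial * Real.exp (K - E) := h.trans (mul_le_mul_of_nonneg_left hprod (Nat.cast_nonneg _))
      _ = (K.factorial * Real.exp K) * Real.exp (-E) := by
        rw [sub_eq_add_neg, Real.exp_add, mul_assoc]
      _ ≤ (Real.exp 1 * K * (K : ℝ) ^ K) * Real.exp (-E) := by
        exact mul_le_mul_of_nonneg_right (factorial_mul_exp_le hK) (Real.exp_pos _).le
      _ ≤ (n * (K : ℝ) ^ K) * Real.exp (-E) := by gcongr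
      _ = _ := by ring
  refine le_of_mul_le_mul_right (hmain.trans (le_of_eq ?_)) (pow_pos hx0 K)
  rw [← hxn, mul_pow]
  ring

theorem card_fiberCard_prefix_le {κ : Type*} [Fintype κ] [DecidableEq κ] {K m : ℕ} (hKm : K ≤ m) (c : κ → ℕ) :
    (Finset.univ.filter fun f : Fin m → κ =>
        ∀ j, (Finset.univ.filter fun i : Fin m => (i : ℕ) < K ∧ f i = j).card ≤ c j).card
      ≤ (Finset.univ.filter fun f : Fin K → κ =>
          ∀ j, (Finset.univ.filter fun i => f i = j).card ≤ c j).card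
        * Fintype.card κ ^ (m - K) := by
  obtain ⟨r, rfl⟩ := Nat.exists_eq_add_of_le hKm
  have hcard : Fintype.card κ ^ (K + r - K) = (Finset.univ : Finset (Fin r → κ)).card := by
    simp
  rw [hcard, ← Finset.card_product]
  refine Finset.card_le_card_of_injOn (Fin.appendEquiv K r).symm (fun f hf => ?_)
    (Fin.appendEquiv K r).symm.injective.injOn
  simp only [Finset.coe_filter, Finset.mem_univ, true_and, Set.mem_ofPred_eq] at hf
  simp only [Finset.coe_product, Finset.coe_filter, Finset.mem_univ, true_and, Finset.coe_univ,
    Set.mem_prod, Set.mem_univ, and_true, Set.mem_ofPred_eq]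
  intro j
  refine le_trans (le_of_eq ?_) (hf j)
  rw [Finset.card_filter, Finset.card_filter, Fin.sum_univ_add]
  simp only [Fin.appendEquiv, Equiv.coe_fn_symm_mk, Fin.val_castAdd, Fin.is_lt, true_and,
    Fin.val_natAdd, Nat.not_lt.2 (Nat.le_add_right _ _), false_and, if_false,
    Finset.sum_const_zero, add_zero]
  exact Finset.sum_congr rfl fun _ _ => if_congr Iff.rfl rfl rfl

theorem one_sub_le_card_firstPhaseEnd_le {n a b m K : ℕ} (hab : a + b = n) (hK : 1 ≤ K)
    (hKn : 10 * K ≤ n) (hKm : K ≤ m) {B : ℝ} (hB : (K : ℝ) ≤ B) :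
    1 - n * Real.exp (-(a * ((K : ℝ) / n) ^ 2 / 3 + b * ((K : ℝ) / n) ^ 3 / 8))
      ≤ ((Finset.univ.filter fun f : Fin m → Fin n => (firstPhaseEnd n a m f : ℝ) ≤ B).card : ℝ)
        / (n : ℝ) ^ m := by
  have hn0 : (0 : ℝ) < n := by exact_mod_cast (by omega : 0 < n)
  set E : ℝ := a * ((K : ℝ) / n) ^ 2 / 3 + b * ((K : ℝ) / n) ^ 3 / 8
  have hsplit := Finset.card_filter_add_card_filter_not (s := (Finset.univ : Finset (Fin m → Fin n)))
    (fun f => (firstPhaseEnd n a m f : ℝ) ≤ B)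
  have hbad : ((Finset.univ.filter fun f : Fin m → Fin n =>
      ¬ (firstPhaseEnd n a m f : ℝ) ≤ B).card : ℝ) ≤ n * Real.exp (-E) * (n : ℝ) ^ m := by
    have hsub : (Finset.univ.filter fun f : Fin m → Fin n => ¬ (firstPhaseEnd n a m f : ℝ) ≤ B)
        ⊆ Finset.univ.filter fun f : Fin m → Fin n =>
          ∀ j, (Finset.univ.filter fun i : Fin m => (i : ℕ) < K ∧ f i = j).card
            ≤ if (j : ℕ) < a then 1 else 2 := by
      intro f hf
      simp only [Finset.mem_filter, Finset.mem_univ, true_and] at hf ⊢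
      intro j
      by_contra hj
      refine hf (le_trans (Nat.cast_le.2 (Nat.sInf_le ⟨j, ?_⟩)) hB)
      split_ifs at hj ⊢ <;> omega
    have hprefix : (Finset.univ.filter fun f : Fin m → Fin n =>
          ∀ j, (Finset.univ.filter fun i : Fin m => (i : ℕ) < K ∧ f i = j).card
            ≤ if (j : ℕ) < a then 1 else 2).card
        ≤ (Finset.univ.filter fun f : Fin K → Fin n =>
            ∀ j, (Finset.univ.filter fun i => f i = j).card
              ≤ if (j : ℕ) < a then 1 else 2).card * n ^ (m - K) := by
      convert card_fiberCard_prefix_le hKm (fun j : Fin n => if (j : ℕ) < a then 1 else 2)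
      exact (Fintype.card_fin n).symm
    have h2 := (Nat.cast_le (α := ℝ)).2 ((Finset.card_le_card hsub).trans hprefix)
    push_cast at h2
    refine h2.trans ((mul_le_mul_of_nonneg_right (card_fiberCard_le_two_le hab hK hKn)
      (by positivity)).trans (le_of_eq ?_))
    rw [mul_right_comm, ← pow_add, Nat.add_sub_cancel' hKm, mul_comm]
  rw [Finset.card_univ, Fintype.card_fun, Fintype.card_fin, Fintype.card_fin] at hsplit
  have hsplit' := congrArg (Nat.cast : ℕ → ℝ) hsplit
  push_cast at hsplit'
  rw [le_div_iff₀ (by positivity)]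
  linarith

theorem mul_div_sqrt_bounds {α n a L : ℝ} (hL : 1 ≤ L) (ha : 1 ≤ a) (han : a ≤ n) :
    1 ≤ n * √L / √a ∧ a * (n * √L / √a) ^ 2 = L * n ^ 2 ∧
      (n ≤ 2 * a → 2 * (20 * α) ^ 2 * L ≤ n → 20 * α * (n * √L / √a) ≤ n) := by
  have ha0 : 0 < a := by linarith
  have hsa : 0 < √a := Real.sqrt_pos.2 ha0
  have hn : 0 < n := ha0.trans_le han
  have hL0 : 0 ≤ L := by linarith
  refine ⟨?_, ?_, fun h2 h => ?_⟩
  · rw [le_div_iff₀ hsa, one_mul]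
    have h1 : √a ≤ a := Real.sqrt_le_iff.2 ⟨ha0.le, by nlinarith⟩
    have h2 : 1 ≤ √L := Real.one_le_sqrt.2 hL
    nlinarith
  · rw [div_pow, mul_pow, Real.sq_sqrt hL0, Real.sq_sqrt ha0.le]
    field_simp
  · rw [← mul_div_assoc, div_le_iff₀ hsa, mul_left_comm]
    refine mul_le_mul_of_nonneg_left (Real.le_sqrt_of_sq_le ?_) hn.le
    rw [mul_pow, Real.sq_sqrt hL0]
    linarith

theorem mul_div_cbrt_bounds {α n b L : ℝ} (hL : 1 ≤ L) (hb : 1 ≤ b) (hbn : b ≤ n) :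
    1 ≤ n * L ^ ((1 : ℝ) / 3) / b ^ ((1 : ℝ) / 3) ∧
      b * (n * L ^ ((1 : ℝ) / 3) / b ^ ((1 : ℝ) / 3)) ^ 3 = L * n ^ 3 ∧
      (n ≤ 2 * b → 2 * (20 * α) ^ 3 * L ≤ n →
        20 * α * (n * L ^ ((1 : ℝ) / 3) / b ^ ((1 : ℝ) / 3)) ≤ n) := by
  have hb0 : 0 < b := by linarith
  have hn : 0 < n := hb0.trans_le hbn
  have hL0 : 0 ≤ L := by linarith
  have hcube : ∀ y : ℝ, 0 ≤ y → (y ^ ((1 : ℝ) / 3)) ^ 3 = y := fun y hy => by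
    rw [← Real.rpow_natCast, ← Real.rpow_mul hy]
    norm_num
  have hsb : 0 < b ^ ((1 : ℝ) / 3) := by positivity
  refine ⟨?_, ?_, fun h2 h => ?_⟩
  · rw [le_div_iff₀ hsb, one_mul]
    have h1 : b ^ ((1 : ℝ) / 3) ≤ b := by
      simpa using Real.rpow_le_rpow_of_exponent_le hb (by norm_num : (1 : ℝ) / 3 ≤ 1)
    have h2 : 1 ≤ L ^ ((1 : ℝ) / 3) := Real.one_le_rpow hL (by norm_num)
    nlinarith
  · rw [div_pow, mul_pow, hcube L hL0, hcube b hb0.le]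
    field_simp
  · rw [← mul_div_assoc, div_le_iff₀ hsb, mul_left_comm]
    refine mul_le_mul_of_nonneg_left (le_of_pow_le_pow_left₀ three_ne_zero hsb.le ?_) hn.le
    rw [mul_pow, hcube L hL0, hcube b hb0.le]
    linarith

theorem one_sub_rpow_le_card_firstPhaseEnd_le {α : ℝ} (hα : 4 ≤ α) {n a b : ℕ} (hab : a + b = n)
    (hn : 1 ≤ n) {M : ℝ} (hM1 : 1 ≤ M) (hMn : 20 * α * M ≤ n)
    (hM : (a : ℝ) * M ^ 2 = Real.log n * n ^ 2 ∨ (b : ℝ) * M ^ 3 = Real.log n * n ^ 3) :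
    1 - 1 / (n : ℝ) ^ α ≤
      ((Finset.univ.filter fun f : Fin (2 * n + 1) → Fin n =>
          (firstPhaseEnd n a (2 * n + 1) f : ℝ) ≤ 2 * α * M).card : ℝ)
        / (n : ℝ) ^ (2 * n + 1) := by
  have hn0 : (0 : ℝ) < n := by exact_mod_cast hn
  have hL0 : 0 ≤ Real.log n := Real.log_natCast_nonneg n
  have hαM : 4 ≤ α * M := by nlinarith
  set K := ⌊2 * α * M⌋₊ with hKdef
  have hKle : (K : ℝ) ≤ 2 * α * M := Nat.floor_le (by linarith)
  have hKge : α * M ≤ K := by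
    have := Nat.lt_floor_add_one (2 * α * M)
    linarith
  have hK1 : 1 ≤ K := by
    have : (1 : ℝ) ≤ K := by linarith
    exact_mod_cast this
  have hKn : 10 * K ≤ n := by
    have : 10 * (K : ℝ) ≤ n := by linarith
    exact_mod_cast this
  refine le_trans ?_ (one_sub_le_card_firstPhaseEnd_le hab hK1 hKn (by omega) hKle)
  have hE : (α + 1) * Real.log n
      ≤ a * ((K : ℝ) / n) ^ 2 / 3 + b * ((K : ℝ) / n) ^ 3 / 8 := by
    have hx : α * M / n ≤ (K : ℝ) / n := by gcongr
    have hx0 : 0 ≤ α * M / n := by positivity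
    rcases hM with hM | hM
    · have h1 : α ^ 2 * Real.log n ≤ a * ((K : ℝ) / n) ^ 2 := by
        calc α ^ 2 * Real.log n = a * (α * M / n) ^ 2 := by
              field_simp
              linarith
          _ ≤ _ := by gcongr
      have h2 : 0 ≤ (b : ℝ) * ((K : ℝ) / n) ^ 3 := by positivity
      have h3 : 3 * (α + 1) * Real.log n ≤ α ^ 2 * Real.log n := by
        gcongr
        nlinarith
      linarith
    · have h1 : α ^ 3 * Real.log n ≤ b * ((K : ℝ) / n) ^ 3 := by
        calc α ^ 3 * Real.log n = b * (α * M / n) ^ 3 := by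
              field_simp
              linarith
          _ ≤ _ := by gcongr
      have h2 : 0 ≤ (a : ℝ) * ((K : ℝ) / n) ^ 2 := by positivity
      have h3 : 8 * (α + 1) * Real.log n ≤ α ^ 3 * Real.log n := by
        gcongr
        nlinarith [mul_nonneg (by linarith : 0 ≤ α) (by nlinarith : 0 ≤ α ^ 2 - 16)]
      linarith
  have hexp : (n : ℝ) * Real.exp (-(a * ((K : ℝ) / n) ^ 2 / 3 + b * ((K : ℝ) / n) ^ 3 / 8))
      ≤ 1 / (n : ℝ) ^ α := by
    calc _ ≤ (n : ℝ) * Real.exp (-((α + 1) * Real.log n)) := by gcongr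
      _ = Real.exp (Real.log n) * Real.exp (-((α + 1) * Real.log n)) := by rw [Real.exp_log hn0]
      _ = 1 / (n : ℝ) ^ α := by
        rw [Real.rpow_def_of_pos hn0, one_div, ← Real.exp_neg, ← Real.exp_add]
        congr 1
        ring
  linarith

/-- Let `α ≥ 4`.  There exists `n₀` such that for all `n ≥ n₀` and all
nonnegative integers `a`, `b` with `a + b = n`: in the game with `n` bins of which `a` start
with one ball and `b` start empty, where each step throws a ball into a uniformly random bin
and `T` is the first step at which some bin contains three balls, we have
`T ≤ 2α·min(n·√(log n)/√a, n·(log n)^{1/3}/b^{1/3})` with probability at least `1 − 1/n^α`;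
a term of the `min` whose denominator is `0` is interpreted as `+∞` (i.e. the `min` is then
the other term). -/
theorem stmt14 (α : ℝ) (hα : 4 ≤ α) :
    ∃ n₀ : ℕ, 1 ≤ n₀ ∧ ∀ n : ℕ, n₀ ≤ n → ∀ a b : ℕ, a + b = n →
      1 - 1 / (n : ℝ) ^ α ≤
        ((Finset.univ.filter fun f : Fin (2 * n + 1) → Fin n =>
            (firstPhaseEnd n a (2 * n + 1) f : ℝ) ≤ 2 * α *
              (if a = 0 then (n : ℝ) * Real.log n ^ ((1 : ℝ) / 3) / (b : ℝ) ^ ((1 : ℝ) / 3)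
               else if b = 0 then (n : ℝ) * Real.sqrt (Real.log n) / Real.sqrt a
               else min ((n : ℝ) * Real.sqrt (Real.log n) / Real.sqrt a)
                        ((n : ℝ) * Real.log n ^ ((1 : ℝ) / 3)
                          / (b : ℝ) ^ ((1 : ℝ) / 3)))).card : ℝ)
          / (n : ℝ) ^ (2 * n + 1) := by
  have hlarge : ∀ᶠ n : ℕ in Filter.atTop,
      1 ≤ Real.log n ∧ 2 * (20 * α) ^ 3 * Real.log n ≤ n := by
    have hlog := Real.isLittleO_log_id_atTop.bound
      (show 0 < 1 / (2 * (20 * α) ^ 3) by positivity)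
    have h := tendsto_natCast_atTop_atTop (R := ℝ) |>.eventually
      (hlog.and (Real.tendsto_log_atTop.eventually_ge_atTop 1))
    filter_upwards [h] with n ⟨h1, h2⟩
    refine ⟨h2, ?_⟩
    rw [Real.norm_of_nonneg (by linarith), id, Real.norm_of_nonneg (by positivity), div_mul_eq_mul_div,
      one_mul, le_div_iff₀ (by positivity)] at h1
    linarith
  obtain ⟨n₁, hn₁⟩ := Filter.eventually_atTop.1 hlarge
  refine ⟨max 1 n₁, le_max_left _ _, fun n hn a b hab => ?_⟩
  have hn1 : 1 ≤ n := (le_max_left _ _).trans hn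
  obtain ⟨hL, hLn⟩ := hn₁ n ((le_max_right _ _).trans hn)
  have hLn' : 2 * (20 * α) ^ 2 * Real.log n ≤ n := by
    refine le_trans ?_ hLn
    gcongr
    · linarith
    · norm_num
  have habR : (a : ℝ) + b = n := by exact_mod_cast hab
  have hA : 0 < a → _ := fun ha =>
    mul_div_sqrt_bounds (α := α) hL (Nat.one_le_cast.2 ha) (show (a : ℝ) ≤ n by linarith [b.cast_nonneg (α := ℝ)])
  have hB : 0 < b → _ := fun hb =>
    mul_div_cbrt_bounds (α := α) hL (Nat.one_le_cast.2 hb) (show (b : ℝ) ≤ n by linarith [a.cast_nonneg (α := ℝ)])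
  split_ifs with ha hb
  · obtain ⟨h1, h2, h3⟩ := hB (by omega)
    refine one_sub_rpow_le_card_firstPhaseEnd_le hα hab hn1 h1 (h3 ?_ hLn) (Or.inr h2)
    simp only [ha, Nat.cast_zero] at habR
    linarith
  · obtain ⟨h1, h2, h3⟩ := hA (by omega)
    refine one_sub_rpow_le_card_firstPhaseEnd_le hα hab hn1 h1 (h3 ?_ hLn') (Or.inl h2)
    simp only [hb, Nat.cast_zero] at habR
    linarith
  · obtain ⟨h1, h2, h3⟩ := hA (by omega)
    obtain ⟨h1', h2', h3'⟩ := hB (by omega)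
    refine one_sub_rpow_le_card_firstPhaseEnd_le hα hab hn1 (le_min h1 h1') ?_ ?_
    · rcases le_total (a : ℝ) b with h | h
      · refine le_trans ?_ (h3' (by linarith) hLn)
        gcongr
        exact min_le_right _ _
      · refine le_trans ?_ (h3 (by linarith) hLn')
        gcongr
        exact min_le_left _ _
    · rcases min_choice ((n : ℝ) * √(Real.log n) / √a)
        ((n : ℝ) * Real.log n ^ ((1 : ℝ) / 3) / (b : ℝ) ^ ((1 : ℝ) / 3)) with h | h <;> rw [h]
      · exact Or.inl h2
      · exact Or.inr h2'
end

section
/- Let n ≥ 1 be an integer and define Z : {0,1,…,n−1} → ℝ by Z(0) = 1 and Z(i) = (i/n)·Z(i−1) + 1 for 1 ≤ i ≤ n−1. Then Z(k) ≤ √n for every integer k with 0 ≤ k ≤ n − √n, and Z(n−1) ≤ 2√n. -/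
/-- The recurrence `Z(0) = 1`, `Z(i) = (i/n)·Z(i−1) + 1` for the expected hitting times of the
winning state in the fetch-and-increment chain. -/
noncomputable def Zfun (n : ℕ) : ℕ → ℝ
  | 0 => 1
  | i + 1 => ((i + 1 : ℕ) : ℝ) / n * Zfun n i + 1

theorem Zfun_nonneg (n k : ℕ) : 0 ≤ Zfun n k := by
  induction k with
  | zero => simp [Zfun]
  | succ k ih => rw [Zfun]; positivity

theorem Zfun_succ_le_add_one {n k : ℕ} (h : k + 1 ≤ n) : Zfun n (k + 1) ≤ Zfun n k + 1 := by
  have hle : ((k + 1 : ℕ) : ℝ) / n ≤ 1 :=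
    div_le_one_of_le₀ (by exact_mod_cast h) (Nat.cast_nonneg n)
  rw [Zfun]
  linarith [mul_le_of_le_one_left (Zfun_nonneg n k) hle]

theorem Zfun_le_sqrt {n : ℕ} (hn : 1 ≤ n) (k : ℕ) (hk : (k : ℝ) ≤ n - √n) :
    Zfun n k ≤ √n := by
  have hn1 : (1 : ℝ) ≤ n := by exact_mod_cast hn
  induction k with
  | zero => simpa [Zfun] using hn
  | succ k ih =>
    have hZ : Zfun n k ≤ √n := ih (by push_cast at hk; linarith)
    have hsq : √(n : ℝ) * √n = n := Real.mul_self_sqrt (by linarith)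
    have hmul : ((k + 1 : ℕ) : ℝ) * Zfun n k ≤ (n - √n) * √n :=
      mul_le_mul hk hZ (Zfun_nonneg n k) ((Nat.cast_nonneg _).trans hk)
    have hdiv : ((k + 1 : ℕ) : ℝ) / n * Zfun n k ≤ √n - 1 := by
      rw [div_mul_eq_mul_div, div_le_iff₀ (by linarith)]
      linarith
    rw [Zfun]
    linarith

theorem Zfun_le_of_sub_sqrt_le {n : ℕ} (hn : 1 ≤ n) (k : ℕ) (hkn : k ≤ n)
    (hk : (n : ℝ) - √n ≤ k) : Zfun n k ≤ 2 * √n + k + 1 - n := by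
  have hs : 1 ≤ √(n : ℝ) := Real.one_le_sqrt.2 (by exact_mod_cast hn)
  induction k with
  | zero =>
    have hsq : √(n : ℝ) * √n = n := Real.mul_self_sqrt (Nat.cast_nonneg n)
    push_cast at hk
    simp only [Zfun, Nat.cast_zero]
    nlinarith
  | succ k ih =>
    have hstep := Zfun_succ_le_add_one hkn
    push_cast at hk ⊢
    rcases le_total (k : ℝ) (n - √n) with h | h
    · linarith [Zfun_le_sqrt hn k h]
    · linarith [ih (by omega) h]

/-- Let `n ≥ 1` and define `Z(0) = 1`, `Z(i) = (i/n)·Z(i−1) + 1` for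
`1 ≤ i ≤ n − 1`.  Then `Z(k) ≤ √n` for every integer `k` with `0 ≤ k ≤ n − √n`, and
`Z(n−1) ≤ 2√n`. -/
theorem stmt17 (n : ℕ) (hn : 1 ≤ n) :
    (∀ k : ℕ, (k : ℝ) ≤ (n : ℝ) - Real.sqrt n → Zfun n k ≤ Real.sqrt n)
    ∧ Zfun n (n - 1) ≤ 2 * Real.sqrt n := by
  refine ⟨Zfun_le_sqrt hn, ?_⟩
  have hs : 1 ≤ √(n : ℝ) := Real.one_le_sqrt.2 (by exact_mod_cast hn)
  have hcast : ((n - 1 : ℕ) : ℝ) = n - 1 := Nat.cast_pred hn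
  have hbound := Zfun_le_of_sub_sqrt_le hn (n - 1) (Nat.sub_le n 1) (by linarith)
  linarith
end

section
/- Fix an integer n ≥ 1 and consider the Markov chain on states {1,…,n} that from state i moves to state 1 with probability i/n and to state i+1 with probability 1 − i/n (in particular, state n moves to state 1 with probability 1, and state 1 has a self-loop with probability 1/n). Then the expected return time to state 1, i.e., E[min{t ≥ 1 : X_t = 1}] for the chain started at X_0 = 1, is at most 2√n. -/
open scoped Classical

/-- Transition matrix of the global fetch-and-increment chain on states `{1, …, n}`, where the
state `k ∈ {1, …, n}` is represented by `(k - 1 : Fin n)`: from state `k` the chain moves to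
state `1` with probability `k/n` and to state `k + 1` with probability `1 − k/n`. -/
noncomputable def casP (n : ℕ) (i j : Fin n) : ℝ :=
  (if (j : ℕ) = 0 then ((i : ℕ) + 1 : ℝ) / n else 0)
  + (if (j : ℕ) = (i : ℕ) + 1 then 1 - ((i : ℕ) + 1 : ℝ) / n else 0)

/-- The return time to state `1` of a trajectory `p`: the least `t ≥ 1` with `p t = 1`
(junk value `0` if the trajectory never returns; such trajectories have probability `0`).
Starting from state `1`, the chain surely returns to state `1` within `n` steps, so
trajectories of length `n + 1` suffice to model the return time `min{t ≥ 1 : X_t = 1}`. -/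
noncomputable def retTime (n : ℕ) (p : Fin (n + 1) → Fin n) : ℕ :=
  sInf {t | 1 ≤ t ∧ ∃ ht : t < n + 1, (p ⟨t, ht⟩ : ℕ) = 0}

/-- The first return time to `0` of a trajectory with `m` steps (`0` if there is no return). -/
noncomputable def firstReturn {n : ℕ} (m : ℕ) (p : Fin (m + 1) → Fin n) : ℕ :=
  sInf {t | 1 ≤ t ∧ ∃ ht : t < m + 1, (p ⟨t, ht⟩ : ℕ) = 0}

/-- The probability weight of a trajectory with `m` steps. -/
noncomputable def pathWeight {n : ℕ} (m : ℕ) (p : Fin (m + 1) → Fin n) : ℝ :=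
  ∏ t : Fin m, casP n (p t.castSucc) (p t.succ)

theorem casP_nonneg {n : ℕ} (i j : Fin n) : 0 ≤ casP n i j := by
  have hn : (0 : ℝ) < n := by exact_mod_cast i.pos
  have hi : ((i : ℕ) + 1 : ℝ) / n ≤ 1 := by
    rw [div_le_one hn]
    exact_mod_cast i.isLt
  unfold casP
  apply add_nonneg
  · split_ifs <;> positivity
  · split_ifs
    · linarith
    · exact le_rfl

theorem sum_casP_mul {n : ℕ} (i : Fin n) (g : ℕ → ℝ) :
    ∑ j : Fin n, casP n i j * g j =
      ((i : ℕ) + 1 : ℝ) / n * g 0 + (1 - ((i : ℕ) + 1 : ℝ) / n) * g (i + 1) := by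
  have hn : (0 : ℝ) < n := by exact_mod_cast i.pos
  refine (Fin.sum_univ_eq_sum_range (fun j => ((if j = 0 then ((i : ℕ) + 1 : ℝ) / n else 0)
    + (if j = (i : ℕ) + 1 then 1 - ((i : ℕ) + 1 : ℝ) / n else 0)) * g j) n).trans ?_
  simp only [add_mul, ite_mul, zero_mul, Finset.sum_add_distrib, Finset.sum_ite_eq',
    Finset.mem_range, i.pos, if_true]
  congr 1
  split_ifs with h
  · rfl
  · have : (i : ℕ) + 1 = n := by omega
    have h' : ((i : ℕ) + 1 : ℝ) = n := by exact_mod_cast this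
    rw [h', div_self hn.ne']
    simp

theorem pathWeight_nonneg {n m : ℕ} (p : Fin (m + 1) → Fin n) : 0 ≤ pathWeight m p :=
  Finset.prod_nonneg fun _ _ => casP_nonneg _ _

theorem pathWeight_cons {n m : ℕ} (i : Fin n) (q : Fin (m + 1) → Fin n) :
    pathWeight (m + 1) (Fin.cons i q : Fin (m + 2) → Fin n) =
      casP n i (q 0) * pathWeight m q := by
  simp [pathWeight, Fin.prod_univ_succ]

theorem firstReturn_cons_le {n m : ℕ} (i : Fin n) (q : Fin (m + 1) → Fin n) :
    firstReturn (m + 1) (Fin.cons i q : Fin (m + 2) → Fin n) ≤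
      1 + if (q 0 : ℕ) = 0 then 0 else firstReturn m q := by
  split_ifs with h
  · exact Nat.sInf_le ⟨le_rfl, by omega, h⟩
  · let S : Set ℕ := {t | 1 ≤ t ∧ ∃ ht : t < m + 1, (q ⟨t, ht⟩ : ℕ) = 0}
    rcases S.eq_empty_or_nonempty with he | hne
    · refine le_trans (le_of_eq ?_) (Nat.zero_le _)
      unfold firstReturn
      rw [Nat.sInf_eq_zero]
      right
      rw [Set.eq_empty_iff_forall_notMem] at he ⊢
      rintro (_ | _ | t) ⟨h1, ht, h0⟩
      · omega
      · exact h h0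
      · exact he (t + 1) ⟨by omega, by omega, h0⟩
    · obtain ⟨h1, ht, h0⟩ := Nat.sInf_mem hne
      refine (Nat.sInf_le ?_).trans (add_comm (sInf S) 1).le
      exact ⟨by omega, by omega, h0⟩

theorem sum_fun_fin_succ {α : Type*} [Fintype α] (m : ℕ) (g : (Fin (m + 1) → α) → ℝ) :
    ∑ p : Fin (m + 1) → α, g p = ∑ a : α, ∑ q : Fin m → α, g (Fin.cons a q) := by
  rw [← Fintype.sum_prod_type']
  exact (Equiv.sum_comp (Fin.consEquiv fun _ => α) g).symm

theorem sum_pathWeight {n : ℕ} (m : ℕ) (i : Fin n) :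
    ∑ q : Fin m → Fin n, pathWeight m (Fin.cons i q : Fin (m + 1) → Fin n) = 1 := by
  induction m generalizing i with
  | zero => simp [pathWeight]
  | succ m ih =>
    rw [sum_fun_fin_succ]
    simp only [pathWeight_cons, Fin.cons_zero, ← Finset.mul_sum, ih]
    rw [sum_casP_mul i fun _ => 1]
    ring

/-- A nonnegative potential that decreases by at least one in expectation at each step before
the return to `0` bounds the expected return time. -/
theorem sum_pathWeight_mul_firstReturn_le {n : ℕ} (f : ℕ → ℝ) (hf : ∀ k, 0 ≤ f k)
    (hstep : ∀ i : Fin n, 1 + (1 - ((i : ℕ) + 1 : ℝ) / n) * f (i + 1) ≤ f i)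
    (m : ℕ) (i : Fin n) :
    ∑ q : Fin m → Fin n, pathWeight m (Fin.cons i q : Fin (m + 1) → Fin n) *
      (firstReturn m (Fin.cons i q : Fin (m + 1) → Fin n) : ℝ) ≤ f i := by
  induction m generalizing i with
  | zero =>
    have h : ∀ p : Fin 1 → Fin n, firstReturn 0 p = 0 := fun p => by
      unfold firstReturn
      rw [Nat.sInf_eq_zero]
      right
      rw [Set.eq_empty_iff_forall_notMem]
      rintro t ⟨h1, ht, -⟩
      omega
    simp [h, hf]
  | succ m ih =>
    have hle : ∀ j : Fin n, ∑ r : Fin m → Fin n,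
        pathWeight (m + 1) (Fin.cons i (Fin.cons j r : Fin (m + 1) → Fin n) : Fin (m + 2) → Fin n) *
        (firstReturn (m + 1)
          (Fin.cons i (Fin.cons j r : Fin (m + 1) → Fin n) : Fin (m + 2) → Fin n) : ℝ) ≤
        casP n i j * (1 + if (j : ℕ) = 0 then 0 else f j) := by
      intro j
      calc
        _ ≤ ∑ r : Fin m → Fin n, casP n i j *
            (pathWeight m (Fin.cons j r : Fin (m + 1) → Fin n) +
              if (j : ℕ) = 0 then 0 else pathWeight m (Fin.cons j r : Fin (m + 1) → Fin n) *
                (firstReturn m (Fin.cons j r : Fin (m + 1) → Fin n) : ℝ)) := by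
          refine Finset.sum_le_sum fun r _ => ?_
          have h := firstReturn_cons_le i (Fin.cons j r : Fin (m + 1) → Fin n)
          have h' := (Nat.cast_le (α := ℝ)).2 h
          rw [pathWeight_cons, Fin.cons_zero, mul_assoc]
          refine mul_le_mul_of_nonneg_left ?_ (casP_nonneg i j)
          refine (mul_le_mul_of_nonneg_left h' (pathWeight_nonneg _)).trans (le_of_eq ?_)
          rw [Fin.cons_zero]
          split_ifs <;> push_cast <;> ring
        _ ≤ _ := by
          rw [← Finset.mul_sum, Finset.sum_add_distrib, sum_pathWeight]
          refine mul_le_mul_of_nonneg_left ?_ (casP_nonneg i j)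
          split_ifs
          · simp
          · linarith [ih j]
    rw [sum_fun_fin_succ]
    refine (Finset.sum_le_sum fun j _ => hle j).trans ?_
    rw [sum_casP_mul i fun k => 1 + if k = 0 then 0 else f k]
    refine le_trans (le_of_eq ?_) (hstep i)
    simp
    ring

theorem one_add_mul_potential_le {s k : ℝ} (hs : 1 ≤ s) (hk : 0 ≤ k) :
    1 + (1 - k / s ^ 2) * (s + max 0 (s - (k + 1))) ≤ s + max 0 (s - k) := by
  have hs0 : 0 < s := by linarith
  have hd : k / s ^ 2 * s = k / s := by field_simp
  have hdn : 0 ≤ k / s ^ 2 := by positivity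
  rcases le_total s (k + 1) with h | h
  · rw [max_eq_left (by linarith : s - (k + 1) ≤ 0)]
    rcases le_total s k with h' | h'
    · have : 1 ≤ k / s := (one_le_div hs0).2 h'
      nlinarith [le_max_left 0 (s - k)]
    · have : 1 - k / s ≤ s - k := by
        have h1 : 1 - k / s = (s - k) / s := by field_simp
        rw [h1]
        exact div_le_self (by linarith) hs
      nlinarith [le_max_right 0 (s - k)]
  · rw [max_eq_right (by linarith : 0 ≤ s - (k + 1)), max_eq_right (by linarith : 0 ≤ s - k)]
    nlinarith

/-- Fix `n ≥ 1` and consider the Markov chain on `{1, …, n}` that from state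
`i` moves to state `1` with probability `i/n` and to state `i + 1` with probability `1 − i/n`.
Then the expected return time to state `1` for the chain started at state `1`, i.e.
`E[min{t ≥ 1 : X_t = 1}]` — computed here as the sum over all length-`n` trajectories started
at state `1`, weighted by their path probabilities, of the first return time — is at most
`2√n`. -/
theorem stmt18 (n : ℕ) (hn : 1 ≤ n) :
    (∑ p : Fin (n + 1) → Fin n,
        if (p 0 : ℕ) = 0 then
          (∏ t : Fin n, casP n (p t.castSucc) (p t.succ)) * (retTime n p : ℝ)
        else 0)
      ≤ 2 * Real.sqrt n := by
  have hs : 1 ≤ Real.sqrt n := Real.one_le_sqrt.2 (by exact_mod_cast hn)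
  have hsq : Real.sqrt n ^ 2 = n := Real.sq_sqrt (Nat.cast_nonneg n)
  have key := sum_pathWeight_mul_firstReturn_le (n := n)
    (fun k => Real.sqrt n + max 0 (Real.sqrt n - ((k : ℝ) + 1))) (fun k => by positivity)
    (fun i => by
      have h := one_add_mul_potential_le (k := ((i : ℕ) : ℝ) + 1) hs (by positivity)
      rw [hsq] at h
      simpa using h) n ⟨0, hn⟩
  rw [sum_fun_fin_succ, Finset.sum_eq_single (⟨0, hn⟩ : Fin n)]
  · simp only [Fin.cons_zero, if_true]
    refine le_trans key ?_
    rw [max_eq_right (by simpa using hs)]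
    push_cast
    linarith
  · intro j _ hj
    have hj' : (j : ℕ) ≠ 0 := fun h => hj (Fin.ext h)
    simp [hj']
  · simp
end

section
/- Fix an integer n ≥ 1. Let M_I be the Markov chain whose states are the nonempty subsets S of {1,…,n}, which from state S chooses i ∈ {1,…,n} uniformly at random and moves to {i} if i ∈ S and to S ∪ {i} if i ∉ S. Let M_G be the Markov chain on {1,…,n} that from state k moves to state 1 with probability k/n and to state k+1 with probability 1 − k/n. Then: (1) both M_I and M_G are ergodic (irreducible and aperiodic); (2) the cardinality map f(S) = |S| is a lifting of M_I to M_G, i.e., for all k, j ∈ {1,…,n}, π(k)·P_G(k,j) = ∑_{S : |S| = k} ∑_{V : |V| = j} π'(S)·P_I(S,V), where π' and π are the unique stationary distributions of M_I and M_G and P_I, P_G their transition matrices; and (3) π'({i}) = π(1)/n for every i ∈ {1,…,n}. -/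
open scoped Classical

/-- States of the individual fetch-and-increment chain `M_I`: nonempty subsets of the set of
processes, recording which processes hold the current value of the register. -/
abbrev FaiState (n : ℕ) := {S : Finset (Fin n) // S.Nonempty}

/-- One step of `M_I` when process `i` is scheduled: if `i ∈ S` it performs a successful CAS
and the state becomes `{i}`; otherwise `i` acquires the current value and the state becomes
`S ∪ {i}`. -/
def faiStep (n : ℕ) (i : Fin n) (S : Finset (Fin n)) : Finset (Fin n) :=
  if i ∈ S then {i} else insert i S

/-- Transition matrix of `M_I`: a uniformly random process is scheduled. -/
noncomputable def faiP (n : ℕ) (S V : FaiState n) : ℝ :=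
  ((Finset.univ.filter fun i : Fin n => faiStep n i S.val = V.val).card : ℝ) / n

/-- `M_I` as a `Matrix`. -/
noncomputable def faiMat (n : ℕ) : Matrix (FaiState n) (FaiState n) ℝ :=
  Matrix.of fun S V => faiP n S V

/-- `M_G` as a `Matrix`. -/
noncomputable def casMat (n : ℕ) : Matrix (Fin n) (Fin n) ℝ :=
  Matrix.of fun i j => casP n i j

section Matrix

variable {ι : Type*} [Fintype ι] [DecidableEq ι] {A : Matrix ι ι ℝ}

theorem matrix_pow_nonneg (hA : ∀ i j, 0 ≤ A i j) (m : ℕ) (i j : ι) : 0 ≤ (A ^ m) i j := by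
  induction m generalizing j with
  | zero =>
    rw [pow_zero, Matrix.one_apply]
    split_ifs <;> norm_num
  | succ m ih =>
    rw [pow_succ, Matrix.mul_apply]
    exact Finset.sum_nonneg fun k _ => mul_nonneg (ih k) (hA k j)

theorem matrix_pow_add_pos (hA : ∀ i j, 0 ≤ A i j) {a b : ℕ} {i j k : ι}
    (hij : 0 < (A ^ a) i j) (hjk : 0 < (A ^ b) j k) : 0 < (A ^ (a + b)) i k := by
  rw [pow_add, Matrix.mul_apply]
  exact Finset.sum_pos' (fun l _ => mul_nonneg (matrix_pow_nonneg hA a i l)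
    (matrix_pow_nonneg hA b l k)) ⟨j, Finset.mem_univ j, mul_pos hij hjk⟩

theorem matrix_pow_self_pos (hA : ∀ i j, 0 ≤ A i j) {i : ι} (h : 0 < A i i) (m : ℕ) :
    0 < (A ^ m) i i := by
  induction m with
  | zero => simp
  | succ m ih => exact matrix_pow_add_pos hA ih (by rwa [pow_one])

theorem vecMul_pow_of_fixed {v : ι → ℝ} (hv : Matrix.vecMul v A = v) (m : ℕ) :
    Matrix.vecMul v (A ^ m) = v := by
  induction m with
  | zero => simp
  | succ m ih => rw [pow_succ, ← Matrix.vecMul_vecMul, ih, hv]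

/-- A matrix with a strictly positive power has at most one stationary distribution. -/
theorem stationary_unique {m : ℕ} (hA : ∀ i j, 0 < (A ^ m) i j) {μ ν : ι → ℝ}
    (hμ : ∀ i, 0 ≤ μ i) (hμ_sum : ∑ i, μ i = 1) (hμ_stat : ∀ j, ∑ i, μ i * A i j = μ j)
    (hν_sum : ∑ i, ν i = 1) (hν_stat : ∀ j, ∑ i, ν i * A i j = ν j) : μ = ν := by
  have hμ_pow : ∀ j, ∑ i, μ i * (A ^ m) i j = μ j :=
    congrFun (vecMul_pow_of_fixed (v := μ) (funext hμ_stat) m)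
  have hν_pow : ∀ j, ∑ i, ν i * (A ^ m) i j = ν j :=
    congrFun (vecMul_pow_of_fixed (v := ν) (funext hν_stat) m)
  have hμ_pos : ∀ j, 0 < μ j := by
    intro j
    obtain ⟨i, -, hi⟩ : ∃ i ∈ Finset.univ, 0 < μ i := by
      by_contra! h
      linarith [Finset.sum_nonpos h]
    rw [← hμ_pow j]
    exact Finset.sum_pos' (fun k _ => mul_nonneg (hμ k) (hA k j).le)
      ⟨i, Finset.mem_univ i, mul_pos hi (hA i j)⟩
  have hne : (Finset.univ : Finset ι).Nonempty := by
    by_contra h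
    rw [Finset.not_nonempty_iff_eq_empty] at h
    simp [h] at hμ_sum
  -- Subtract from `ν` the largest multiple of `μ` below it: the difference vanishes somewhere.
  obtain ⟨s, -, hs⟩ := Finset.exists_min_image Finset.univ (fun i => ν i / μ i) hne
  set t := ν s / μ s with ht
  have hnn : ∀ i, 0 ≤ ν i - t * μ i := fun i => by
    have := (le_div_iff₀ (hμ_pos i)).1 (hs i (Finset.mem_univ i))
    linarith
  have hzero : ∑ i, (ν i - t * μ i) * (A ^ m) i s = 0 := by
    have : ν s = t * μ s := by rw [ht, div_mul_cancel₀ _ (hμ_pos s).ne']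
    simp only [sub_mul, Finset.sum_sub_distrib, mul_assoc, ← Finset.mul_sum]
    rw [hν_pow, hμ_pow, this, sub_self]
  have hprop : ∀ i, ν i = t * μ i := fun i => by
    have := (Finset.sum_eq_zero_iff_of_nonneg
      fun k _ => mul_nonneg (hnn k) (hA k s).le).1 hzero i (Finset.mem_univ i)
    have := (mul_eq_zero.1 this).resolve_right (hA i s).ne'
    linarith
  have ht_one : t = 1 := by
    rw [← hν_sum, Finset.sum_congr rfl fun i _ => hprop i, ← Finset.mul_sum, hμ_sum, mul_one]
  funext i
  rw [hprop i, ht_one, one_mul]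

end Matrix

section GlobalChain

variable {n : ℕ}

theorem casMat_nonneg (i j : Fin n) : 0 ≤ casMat n i j := by
  have hn : (0 : ℝ) < n := by exact_mod_cast i.pos
  have hi : ((i : ℕ) + 1 : ℝ) ≤ n := by exact_mod_cast i.isLt
  have : ((i : ℕ) + 1 : ℝ) / n ≤ 1 := (div_le_one hn).2 hi
  rw [casMat, Matrix.of_apply, casP]
  refine add_nonneg ?_ ?_ <;> split_ifs
  · positivity
  · rfl
  · linarith
  · rfl

theorem casP_reset_pos (hn : 0 < n) (i : Fin n) : 0 < casP n i ⟨0, hn⟩ := by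
  have : (0 : ℝ) < n := by exact_mod_cast hn
  simp only [casP, if_true, (Nat.succ_ne_zero _).symm, if_false, add_zero]
  positivity

theorem casP_succ_pos (i j : Fin n) (h : (j : ℕ) = i + 1) : 0 < casP n i j := by
  have hn : (0 : ℝ) < n := by exact_mod_cast i.pos
  have hi : ((i : ℕ) + 1 : ℝ) < n := by exact_mod_cast h ▸ j.isLt
  have : ((i : ℕ) + 1 : ℝ) / n < 1 := (div_lt_one hn).2 hi
  simp only [casP, h, Nat.succ_ne_zero, if_true, if_false, zero_add]
  linarith

theorem casMat_pow_climb_pos (hn : 0 < n) (j : ℕ) (hj : j < n) :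
    0 < (casMat n ^ j) ⟨0, hn⟩ ⟨j, hj⟩ := by
  induction j with
  | zero => simp
  | succ j ih =>
    refine matrix_pow_add_pos casMat_nonneg (ih (by omega)) ?_
    rw [pow_one]
    exact casP_succ_pos _ _ rfl

theorem casMat_pow_pos (hn : 0 < n) (k j : Fin n) : 0 < (casMat n ^ n) k j := by
  have h1 : 0 < (casMat n ^ 1) k ⟨0, hn⟩ := by
    rw [pow_one]
    exact casP_reset_pos hn k
  have h2 := matrix_pow_self_pos (A := casMat n) casMat_nonneg
    (casP_reset_pos hn ⟨0, hn⟩) (n - 1 - j)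
  have h := matrix_pow_add_pos casMat_nonneg (matrix_pow_add_pos casMat_nonneg h1 h2)
    (casMat_pow_climb_pos hn j j.isLt)
  rwa [show 1 + (n - 1 - (j : ℕ)) + j = n by omega] at h

end GlobalChain

section IndividualChain

variable {n : ℕ}

theorem faiStep_of_mem {i : Fin n} {S : Finset (Fin n)} (h : i ∈ S) : faiStep n i S = {i} :=
  if_pos h

theorem faiStep_of_notMem {i : Fin n} {S : Finset (Fin n)} (h : i ∉ S) :
    faiStep n i S = insert i S :=
  if_neg h

theorem mem_faiStep (i : Fin n) (S : Finset (Fin n)) : i ∈ faiStep n i S := by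
  by_cases h : i ∈ S
  · simp [faiStep_of_mem h]
  · simp [faiStep_of_notMem h]

theorem faiMat_nonneg (S V : FaiState n) : 0 ≤ faiMat n S V := by
  rw [faiMat, Matrix.of_apply, faiP]
  positivity

theorem faiP_pos {S V : FaiState n} (i : Fin n) (h : faiStep n i S.val = V.val) :
    0 < faiP n S V := by
  have hn : (0 : ℝ) < n := by exact_mod_cast i.pos
  refine div_pos ?_ hn
  exact_mod_cast Finset.card_pos.2 ⟨i, by simpa using h⟩

/-- The state in which only process `i` holds the current value. -/
def faiSingleton (i : Fin n) : FaiState n := ⟨{i}, Finset.singleton_nonempty i⟩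

theorem faiP_to_singleton_pos {S : FaiState n} {i : Fin n} (h : i ∈ S.val) :
    0 < faiP n S (faiSingleton i) :=
  faiP_pos i (faiStep_of_mem h)

theorem faiP_singleton_self_pos (i : Fin n) : 0 < faiP n (faiSingleton i) (faiSingleton i) :=
  faiP_to_singleton_pos (Finset.mem_singleton_self i)

theorem faiMat_sq_singleton_pos (i v : Fin n) :
    0 < (faiMat n ^ 2) (faiSingleton i) (faiSingleton v) := by
  by_cases h : v = i
  · subst h
    exact matrix_pow_self_pos faiMat_nonneg (faiP_singleton_self_pos v) 2
  · let W : FaiState n := ⟨{v, i}, Finset.insert_nonempty _ _⟩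
    have h1 : 0 < (faiMat n ^ 1) (faiSingleton i) W := by
      rw [pow_one]
      exact faiP_pos v (faiStep_of_notMem (by simpa [faiSingleton] using h))
    have h2 : 0 < (faiMat n ^ 1) W (faiSingleton v) := by
      rw [pow_one]
      exact faiP_to_singleton_pos (Finset.mem_insert_self v {i})
    exact matrix_pow_add_pos faiMat_nonneg h1 h2

theorem faiMat_pow_grow_pos (v : Fin n) (T : Finset (Fin n)) (hT : v ∉ T) :
    0 < (faiMat n ^ T.card) (faiSingleton v) ⟨insert v T, Finset.insert_nonempty v T⟩ := by
  induction T using Finset.induction_on with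
  | empty =>
    rw [Finset.card_empty, pow_zero, Matrix.one_apply,
      if_pos (Subtype.ext (by simp [faiSingleton]))]
    exact one_pos
  | insert a T ha ih =>
    rw [Finset.mem_insert, not_or] at hT
    rw [Finset.card_insert_of_notMem ha]
    refine matrix_pow_add_pos faiMat_nonneg (ih hT.2) ?_
    rw [pow_one]
    refine faiP_pos a ?_
    rw [faiStep_of_notMem (by simp [ha, Ne.symm hT.1]), Finset.insert_comm]

theorem faiMat_pow_pos (S V : FaiState n) : 0 < (faiMat n ^ (n + 3)) S V := by
  obtain ⟨i, hi⟩ := S.property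
  obtain ⟨v, hv⟩ := V.property
  have h1 : 0 < (faiMat n ^ 1) S (faiSingleton i) := by
    rw [pow_one]
    exact faiP_to_singleton_pos hi
  have hcard : (V.val.erase v).card ≤ n := by
    simpa using Finset.card_le_univ (V.val.erase v)
  have h2 := matrix_pow_self_pos (A := faiMat n) faiMat_nonneg (faiP_singleton_self_pos v)
    (n - (V.val.erase v).card)
  have h3 := faiMat_pow_grow_pos v (V.val.erase v) (Finset.notMem_erase v _)
  have hV : (⟨insert v (V.val.erase v), Finset.insert_nonempty v _⟩ : FaiState n) = V :=
    Subtype.ext (Finset.insert_erase hv)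
  rw [hV] at h3
  have h := matrix_pow_add_pos faiMat_nonneg (matrix_pow_add_pos faiMat_nonneg
    (matrix_pow_add_pos faiMat_nonneg h1 (faiMat_sq_singleton_pos i v)) h2) h3
  rwa [show 1 + 2 + (n - (V.val.erase v).card) + (V.val.erase v).card = n + 3 by omega] at h

/-- The permutation of the states of `M_I` induced by a permutation of the processes. -/
def faiPerm (σ : Equiv.Perm (Fin n)) : Equiv.Perm (FaiState n) :=
  σ.finsetCongr.subtypeEquiv fun S => by simp

theorem faiPerm_val (σ : Equiv.Perm (Fin n)) (S : FaiState n) :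
    (faiPerm σ S).val = S.val.map σ.toEmbedding :=
  rfl

theorem faiStep_map (σ : Equiv.Perm (Fin n)) (i : Fin n) (S : Finset (Fin n)) :
    faiStep n (σ i) (S.map σ.toEmbedding) = (faiStep n i S).map σ.toEmbedding := by
  by_cases h : i ∈ S
  · rw [faiStep_of_mem h, faiStep_of_mem (by simpa using h)]
    simp
  · rw [faiStep_of_notMem h, faiStep_of_notMem (by simpa using h), Finset.map_insert]
    rfl

theorem faiP_perm (σ : Equiv.Perm (Fin n)) (S V : FaiState n) :
    faiP n (faiPerm σ S) (faiPerm σ V) = faiP n S V := by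
  unfold faiP
  congr 2
  refine (Finset.card_equiv σ fun i => ?_).symm
  rw [Finset.mem_filter_univ, Finset.mem_filter_univ, faiPerm_val, faiPerm_val, faiStep_map,
    Finset.map_inj]

theorem stationary_faiPerm {π' : FaiState n → ℝ} (hnn : ∀ S, 0 ≤ π' S) (hsum : ∑ S, π' S = 1)
    (hstat : ∀ V, ∑ S, π' S * faiP n S V = π' V) (σ : Equiv.Perm (Fin n)) (S : FaiState n) :
    π' (faiPerm σ S) = π' S := by
  refine congrFun (stationary_unique (A := faiMat n) (μ := fun S => π' (faiPerm σ S))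
    faiMat_pow_pos (fun S => hnn _) ?_ (fun V => ?_) hsum hstat) S
  · rw [Equiv.sum_comp (faiPerm σ) π', hsum]
  · rw [← hstat (faiPerm σ V),
      ← Equiv.sum_comp (faiPerm σ) fun S => π' S * faiP n S (faiPerm σ V)]
    exact Finset.sum_congr rfl fun S _ => congrArg _ (faiP_perm σ S V).symm

end IndividualChain

section Lifting

variable {n : ℕ}

/-- The cardinality map `f` from `M_I` to `M_G`, with `k` represented by `k - 1 : Fin n`. -/
def faiCard (S : FaiState n) : Fin n :=
  ⟨S.val.card - 1, by
    have h1 := S.property.card_pos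
    have h2 : S.val.card ≤ n := by simpa using Finset.card_le_univ S.val
    omega⟩

theorem card_eq_faiCard_add_one (S : FaiState n) : S.val.card = faiCard S + 1 := by
  have := S.property.card_pos
  simp only [faiCard]
  omega

theorem faiCard_eq_iff (S : FaiState n) (k : Fin n) : faiCard S = k ↔ S.val.card = k + 1 := by
  rw [card_eq_faiCard_add_one, Fin.ext_iff, Nat.add_right_cancel_iff]

theorem sum_faiP_card (S : FaiState n) (j : Fin n) :
    ∑ V with faiCard V = j, faiP n S V = casP n (faiCard S) j := by
  have hn : (n : ℝ) ≠ 0 := by exact_mod_cast j.pos.ne'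
  have hcount : ∀ V : FaiState n, faiP n S V
      = ∑ i : Fin n, (if V = ⟨faiStep n i S.val, i, mem_faiStep i _⟩ then (1 : ℝ) else 0) / n := by
    intro V
    rw [← Finset.sum_div, Finset.sum_boole, faiP]
    congr 3
    ext i
    simp [Subtype.ext_iff, eq_comm]
  have hstep : ∀ i : Fin n, (∑ V with faiCard V = j,
        (if V = ⟨faiStep n i S.val, i, mem_faiStep i _⟩ then (1 : ℝ) else 0) / n)
      = if i ∈ S.val then (if (j : ℕ) = 0 then 1 / (n : ℝ) else 0)
        else (if (j : ℕ) = (faiCard S : ℕ) + 1 then 1 / (n : ℝ) else 0) := by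
    intro i
    rw [← Finset.sum_div, Finset.sum_ite_eq']
    simp only [Finset.mem_filter, Finset.mem_univ, true_and, faiCard_eq_iff]
    by_cases hi : i ∈ S.val
    · simp only [faiStep_of_mem hi, Finset.card_singleton, hi, if_true]
      by_cases hj : (j : ℕ) = 0 <;> simp [hj]
    · simp only [faiStep_of_notMem hi, Finset.card_insert_of_notMem hi, hi, if_false,
        card_eq_faiCard_add_one S, Nat.add_right_cancel_iff]
      by_cases hj : (j : ℕ) = (faiCard S : ℕ) + 1
      · simp [hj]
      · simp [hj, Ne.symm hj]
  rw [Finset.sum_congr rfl fun V _ => hcount V, Finset.sum_comm,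
    Finset.sum_congr rfl fun i _ => hstep i, Finset.sum_ite]
  have hcompl : ((Finset.univ.filter fun i => i ∉ S.val).card : ℝ) = n - ((faiCard S : ℕ) + 1) := by
    rw [eq_sub_iff_add_eq, ← Nat.cast_add_one, ← card_eq_faiCard_add_one, ← Nat.cast_add,
      Finset.filter_not, Finset.filter_univ_mem, Finset.card_sdiff_add_card_eq_card
        (Finset.subset_univ _), Finset.card_univ, Fintype.card_fin]
  rw [Finset.sum_const, Finset.sum_const, nsmul_eq_mul, nsmul_eq_mul, hcompl,
    Finset.filter_univ_mem, card_eq_faiCard_add_one, Nat.cast_add_one, casP]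
  congr 1
  · split_ifs <;> ring
  · split_ifs
    · field_simp
    · ring

/-- The push-forward of a stationary distribution of `M_I` along the cardinality map is the
stationary distribution of `M_G`. -/
theorem stationary_eq_sum_fiber {π' : FaiState n → ℝ} {π : Fin n → ℝ}
    (hsum' : ∑ S, π' S = 1) (hstat' : ∀ V, ∑ S, π' S * faiP n S V = π' V)
    (hnn : ∀ k, 0 ≤ π k) (hsum : ∑ k, π k = 1) (hstat : ∀ j, ∑ k, π k * casP n k j = π j)
    (k : Fin n) : π k = ∑ S with faiCard S = k, π' S := by
  refine congrFun (stationary_unique (A := casMat n) (casMat_pow_pos k.pos) hnn hsum hstat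
    (ν := fun k => ∑ S with faiCard S = k, π' S) ?_ fun j => ?_) k
  · rw [Finset.sum_fiberwise, hsum']
  · calc ∑ k, (∑ S with faiCard S = k, π' S) * casP n k j
        = ∑ k, ∑ S with faiCard S = k, π' S * casP n (faiCard S) j := by
          refine Finset.sum_congr rfl fun k _ => ?_
          rw [Finset.sum_mul]
          refine Finset.sum_congr rfl fun S hS => ?_
          rw [(Finset.mem_filter.1 hS).2]
      _ = ∑ S, ∑ V with faiCard V = j, π' S * faiP n S V := by
          rw [Finset.sum_fiberwise]
          simp only [← sum_faiP_card, Finset.mul_sum]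
      _ = ∑ V with faiCard V = j, π' V := by
          rw [Finset.sum_comm]
          simp only [hstat']

theorem sum_fiber_zero (hn : 0 < n) (g : FaiState n → ℝ) :
    ∑ S with faiCard S = ⟨0, hn⟩, g S = ∑ i, g (faiSingleton i) := by
  refine (Finset.sum_bij (fun i _ => faiSingleton i) (fun i _ => ?_) (fun i _ j _ h => ?_)
    (fun S hS => ?_) fun _ _ => rfl).symm
  · simp [faiCard_eq_iff, faiSingleton]
  · simpa [faiSingleton] using h
  · rw [Finset.mem_filter, faiCard_eq_iff, zero_add, Finset.card_eq_one] at hS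
    obtain ⟨i, hi⟩ := hS.2
    exact ⟨i, Finset.mem_univ i, Subtype.ext hi.symm⟩

end Lifting

/-- Fix `n ≥ 1` and let `M_I`, `M_G` be the individual and global chains of
the fetch-and-increment counter, with stationary distributions `π'`, `π` (unique, by
ergodicity).  Then: (1) both chains are ergodic (some power of each transition matrix has all
entries strictly positive); (2) the cardinality map `f(S) = |S|` is a lifting of `M_I` to
`M_G`: `π(k)·P_G(k,j) = ∑_{|S|=k} ∑_{|V|=j} π'(S)·P_I(S,V)` for all `k, j ∈ {1, …, n}`; and
(3) `π'({i}) = π(1)/n` for every process `i`. -/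
theorem stmt19 (n : ℕ) (hn : 1 ≤ n)
    (π' : FaiState n → ℝ) (hnn' : ∀ S, 0 ≤ π' S) (hsum' : ∑ S : FaiState n, π' S = 1)
    (hstat' : ∀ V : FaiState n, ∑ S : FaiState n, π' S * faiP n S V = π' V)
    (π : Fin n → ℝ) (hnn : ∀ k, 0 ≤ π k) (hsum : ∑ k : Fin n, π k = 1)
    (hstat : ∀ j : Fin n, ∑ k : Fin n, π k * casP n k j = π j) :
    (∃ m : ℕ, 1 ≤ m ∧ ∀ S V : FaiState n, 0 < (faiMat n ^ m) S V)
    ∧ (∃ m : ℕ, 1 ≤ m ∧ ∀ k j : Fin n, 0 < (casMat n ^ m) k j)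
    ∧ (∀ k j : Fin n,
        π k * casP n k j
          = ∑ S : FaiState n, ∑ V : FaiState n,
              if S.val.card = (k : ℕ) + 1 ∧ V.val.card = (j : ℕ) + 1
              then π' S * faiP n S V else 0)
    ∧ (∀ i : Fin n, π' ⟨{i}, Finset.singleton_nonempty i⟩ = π ⟨0, hn⟩ / n) := by
  have hfiber := stationary_eq_sum_fiber hsum' hstat' hnn hsum hstat
  refine ⟨⟨n + 3, by omega, faiMat_pow_pos⟩, ⟨n, hn, casMat_pow_pos hn⟩, fun k j => ?_,
    fun i => ?_⟩
  · rw [hfiber, Finset.sum_mul, Finset.sum_filter]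
    refine Finset.sum_congr rfl fun S _ => ?_
    simp only [← faiCard_eq_iff, ite_and]
    split_ifs with h
    · rw [← h, ← sum_faiP_card, Finset.mul_sum, Finset.sum_filter]
    · simp
  · have hn0 : (n : ℝ) ≠ 0 := by exact_mod_cast (Nat.pos_of_ne_zero (by omega : n ≠ 0)).ne'
    have hsymm : ∀ j, π' (faiSingleton j) = π' (faiSingleton i) := fun j => by
      rw [← stationary_faiPerm hnn' hsum' hstat' (Equiv.swap i j) (faiSingleton i)]
      congr 1
      exact Subtype.ext (by simp [faiPerm_val, faiSingleton])
    rw [hfiber, sum_fiber_zero, Finset.sum_congr rfl fun j _ => hsymm j, Finset.sum_const,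
      Finset.card_univ, Fintype.card_fin, nsmul_eq_mul, mul_div_cancel_left₀ _ hn0]
    rfl
end
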